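/- Let Λ be a representation-infinite artin algebra. Then there exist Gabriel–Roiter measures I₁, I₂, I₃, … and …, I³, I², I¹ for Λ with I₁ ≺ I₂ ≺ I₃ ≺ ⋯ and ⋯ ≺ I³ ≺ I² ≺ I¹, such that every GR measure I for Λ that is not equal to any I_i or any Iⁱ satisfies I_i ≺ I ≺ Iⁱ for all i ≥ 1. -/

import Mathlib

/-- The Gabriel–Roiter total order on sets of natural numbers: `I ≺ J` iff
`I ≠ J` and the least element of the symmetric difference belongs to `J`.
(All sets occurring as Gabriel–Roiter measures consist of positive integers.) -/
def GRlt (I J : Set ℕ) : Prop :=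
  I ≠ J ∧ ∃ m ∈ (I \ J) ∪ (J \ I), (∀ k ∈ (I \ J) ∪ (J \ I), m ≤ k) ∧ m ∈ J

/-- `I ≼ J` iff `I = J` or `I ≺ J`. -/
def GRle (I J : Set ℕ) : Prop := I = J ∨ GRlt I J

/-- A module is indecomposable if it is nonzero and is not the internal direct
sum of two nonzero submodules. -/
def IsIndecomposableModule (Λ : Type*) [Ring Λ] (M : Type*) [AddCommGroup M]
    [Module Λ M] : Prop :=
  (⊤ : Submodule Λ M) ≠ ⊥ ∧
    ¬ ∃ A B : Submodule Λ M, A ≠ ⊥ ∧ B ≠ ⊥ ∧ IsCompl A B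

open Classical in
/-- The (composition series) length `|M|` of a finite length module `M`,
defined via a composition series from `⊥` to `⊤` (any two such have the same
length by the Jordan–Hölder theorem); it is `0` if no such series exists. -/
noncomputable def mlen (Λ : Type*) [Ring Λ] (M : Type*) [AddCommGroup M]
    [Module Λ M] : ℕ :=
  if h : ∃ s : CompositionSeries (Submodule Λ M), s.head = ⊥ ∧ s.last = ⊤ then
    h.choose.length
  else 0

/-- The collection of subsets of `ℕ` of the form `{|M₁|, …, |M_t|}` where
`M₁ ⊂ M₂ ⊂ ⋯ ⊂ M_t` ranges over (finite, nonempty) chains of indecomposable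
submodules of `M`. -/
def grChainSets (Λ : Type*) [Ring Λ] (M : Type*) [AddCommGroup M]
    [Module Λ M] : Set (Set ℕ) :=
  { S | ∃ (t : ℕ) (c : Fin (t + 1) → Submodule Λ M), StrictMono c ∧
      (∀ i, IsIndecomposableModule Λ (c i)) ∧
      S = Set.range fun i => mlen Λ (c i) }

open Classical in
/-- The Gabriel–Roiter measure `μ(M)`: the maximum, with respect to the total
order `≺`, of the sets of lengths of chains of indecomposable submodules of
`M` (and `∅` if this maximum does not exist, e.g. for `M = 0`). -/
noncomputable def grMeasure (Λ : Type*) [Ring Λ] (M : Type*) [AddCommGroup M]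
    [Module Λ M] : Set ℕ :=
  if h : ∃ S, S ∈ grChainSets Λ M ∧ ∀ S' ∈ grChainSets Λ M, GRle S' S then
    h.choose
  else ∅
universe u

/-- A bundled `Λ`-module (in the same universe as `Λ`). -/
structure BundledMod (Λ : Type u) [Ring Λ] : Type (u + 1) where
  carrier : Type u
  [isAddCommGroup : AddCommGroup carrier]
  [isModule : Module Λ carrier]

attribute [instance] BundledMod.isAddCommGroup BundledMod.isModule

/-- `Λ` has finite representation type: there are only finitely many
isomorphism classes of indecomposable finitely generated `Λ`-modules, i.e.
there is a finite list of modules such that every indecomposable finitely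
generated `Λ`-module is isomorphic to one of them. -/
def HasFiniteRepType (Λ : Type u) [Ring Λ] : Prop :=
  ∃ (n : ℕ) (rep : Fin n → BundledMod Λ),
    ∀ (M : Type u) (_ : AddCommGroup M) (_ : Module Λ M),
      Module.Finite Λ M → IsIndecomposableModule Λ M →
        ∃ i, Nonempty (M ≃ₗ[Λ] (rep i).carrier)

/-- `I` is a Gabriel–Roiter measure for `Λ` if `I = μ(M)` for some
indecomposable finitely generated `Λ`-module `M`. -/
def IsGRMeasureOf (Λ : Type u) [Ring Λ] (I : Set ℕ) : Prop :=
  ∃ (M : Type u) (_ : AddCommGroup M) (_ : Module Λ M),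
    Module.Finite Λ M ∧ IsIndecomposableModule Λ M ∧ grMeasure Λ M = I

/-- `J` is a direct successor of `I` (and `I` a direct predecessor of `J`):
both are GR measures for `Λ`, `I ≺ J`, and no GR measure lies strictly
between them. -/
def IsDirectSuccessor (Λ : Type u) [Ring Λ] (I J : Set ℕ) : Prop :=
  IsGRMeasureOf Λ I ∧ IsGRMeasureOf Λ J ∧ GRlt I J ∧
    ¬ ∃ K, IsGRMeasureOf Λ K ∧ GRlt I K ∧ GRlt K J

/-- A GR segment: a nonempty set of GR measures closed under taking direct
successors and direct predecessors. -/
def IsGRSegment (Λ : Type u) [Ring Λ] (S : Set (Set ℕ)) : Prop :=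
  S.Nonempty ∧ (∀ I ∈ S, IsGRMeasureOf Λ I) ∧
    ∀ I ∈ S, ∀ J, (IsDirectSuccessor Λ I J ∨ IsDirectSuccessor Λ J I) → J ∈ S

theorem grlt_iff {I J : Set ℕ} :
    GRlt I J ↔ ∃ m, m ∈ J ∧ m ∉ I ∧ ∀ k < m, (k ∈ I ↔ k ∈ J) := by
  constructor
  · rintro ⟨-, m, hm, hmin, hJ⟩
    refine ⟨m, hJ, ?_, fun k hk => ?_⟩
    · rcases hm with hm | hm
      · exact absurd hJ hm.2
      · exact hm.2
    · by_contra hne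
      have : k ∈ (I \ J) ∪ (J \ I) := by
        simp only [Set.mem_union, Set.mem_sdiff]
        tauto
      exact absurd (hmin k this) (by omega)
  · rintro ⟨m, hJ, hI, h⟩
    refine ⟨fun e => hI (e ▸ hJ), m, Or.inr ⟨hJ, hI⟩, fun k hk => ?_, hJ⟩
    by_contra hlt
    have := h k (by omega)
    simp only [Set.mem_union, Set.mem_sdiff] at hk
    tauto

theorem grlt_irrefl (I : Set ℕ) : ¬ GRlt I I := fun h => h.1 rfl

theorem GRlt.trans {I J K : Set ℕ} (h₁ : GRlt I J) (h₂ : GRlt J K) : GRlt I K := by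
  rw [grlt_iff] at *
  obtain ⟨m, mJ, mI, hm⟩ := h₁
  obtain ⟨n, nK, nJ, hn⟩ := h₂
  rcases lt_trichotomy m n with h | rfl | h
  · exact ⟨m, (hn m h).1 mJ, mI, fun k hk => (hm k hk).trans (hn k (hk.trans h))⟩
  · exact absurd mJ nJ
  · exact ⟨n, nK, fun hI => nJ ((hm n h).1 hI),
      fun k hk => (hm k (hk.trans h)).trans (hn k hk)⟩

theorem grlt_trichotomy (I J : Set ℕ) : GRlt I J ∨ I = J ∨ GRlt J I := by
  classical
  by_cases hIJ : I = J
  · exact Or.inr (Or.inl hIJ)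
  have hex : ∃ m, ¬ (m ∈ I ↔ m ∈ J) := by
    by_contra h
    push Not at h
    exact hIJ (Set.ext h)
  have h₁ := Nat.find_spec hex
  have h₂ : ∀ k < Nat.find hex, (k ∈ I ↔ k ∈ J) := fun k hk => not_not.1 (Nat.find_min hex hk)
  simp only [grlt_iff]
  by_cases hJ : Nat.find hex ∈ J
  · exact Or.inl ⟨_, hJ, by tauto, h₂⟩
  · exact Or.inr (Or.inr ⟨_, by tauto, hJ, fun k hk => (h₂ k hk).symm⟩)

theorem GRle.trans {I J K : Set ℕ} (h₁ : GRle I J) (h₂ : GRle J K) : GRle I K := by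
  rcases h₁ with rfl | h₁
  · exact h₂
  rcases h₂ with rfl | h₂
  · exact Or.inr h₁
  · exact Or.inr (h₁.trans h₂)

theorem GRlt.trans_le {I J K : Set ℕ} (h₁ : GRlt I J) (h₂ : GRle J K) : GRlt I K := by
  rcases h₂ with rfl | h₂
  · exact h₁
  · exact h₁.trans h₂

theorem GRle.trans_lt {I J K : Set ℕ} (h₁ : GRle I J) (h₂ : GRlt J K) : GRlt I K := by
  rcases h₁ with rfl | h₁
  · exact h₂
  · exact h₁.trans h₂

theorem grle_of_not_grlt {I J : Set ℕ} (h : ¬ GRlt I J) : GRle J I := by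
  rcases grlt_trichotomy I J with h' | h' | h'
  · exact absurd h' h
  · exact Or.inl h'.symm
  · exact Or.inr h'

theorem GRle.not_grlt {I J : Set ℕ} (h : GRle I J) : ¬ GRlt J I :=
  fun h' => grlt_irrefl _ (h.trans_lt h')

theorem GRle.antisymm {I J : Set ℕ} (h₁ : GRle I J) (h₂ : GRle J I) : I = J := by
  rcases h₁ with rfl | h₁
  · rfl
  · exact absurd h₁ h₂.not_grlt

/-- Every nonempty finite family of sets of natural numbers has a `≼`-maximal member. -/
theorem exists_grle_max {𝒮 : Set (Set ℕ)} (hf : 𝒮.Finite) (hne : 𝒮.Nonempty) :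
    ∃ S ∈ 𝒮, ∀ T ∈ 𝒮, GRle T S := by
  induction 𝒮, hf using Set.Finite.induction_on with
  | empty => exact absurd hne (by simp)
  | @insert a s _ _ ih =>
    rcases s.eq_empty_or_nonempty with rfl | hs
    · exact ⟨a, by simp, fun T hT => Or.inl (by simpa using hT)⟩
    · obtain ⟨S, hS, hmax⟩ := ih hs
      by_cases h : GRlt a S
      · refine ⟨S, Or.inr hS, fun T hT => ?_⟩
        rcases hT with rfl | hT
        · exact Or.inr h
        · exact hmax T hT
      · refine ⟨a, Or.inl rfl, fun T hT => ?_⟩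
        rcases hT with rfl | hT
        · exact Or.inl rfl
        · exact (hmax T hT).trans (grle_of_not_grlt h)

/-- Every nonempty finite family of sets of natural numbers has a `≼`-minimal member. -/
theorem exists_grle_min {𝒮 : Set (Set ℕ)} (hf : 𝒮.Finite) (hne : 𝒮.Nonempty) :
    ∃ S ∈ 𝒮, ∀ T ∈ 𝒮, GRle S T := by
  induction 𝒮, hf using Set.Finite.induction_on with
  | empty => exact absurd hne (by simp)
  | @insert a s _ _ ih =>
    rcases s.eq_empty_or_nonempty with rfl | hs
    · exact ⟨a, by simp, fun T hT => Or.inl (Set.mem_singleton_iff.1 (by simpa using hT)).symm⟩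
    · obtain ⟨S, hS, hmin⟩ := ih hs
      by_cases h : GRlt S a
      · refine ⟨S, Or.inr hS, fun T hT => ?_⟩
        rcases hT with rfl | hT
        · exact Or.inr h
        · exact hmin T hT
      · refine ⟨a, Or.inl rfl, fun T hT => ?_⟩
        rcases hT with rfl | hT
        · exact Or.inl rfl
        · exact (grle_of_not_grlt h).trans (hmin T hT)

/-- If `I ≺ J` and all elements of `J` are smaller than `n`, then also `I ∪ {n} ≺ J`. -/
theorem GRlt.insert_of_forall_lt {I J : Set ℕ} {n : ℕ} (h : GRlt I J) (hJ : ∀ k ∈ J, k < n) :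
    GRlt (insert n I) J := by
  rw [grlt_iff] at *
  obtain ⟨m, mJ, mI, hm⟩ := h
  have hmn := hJ m mJ
  refine ⟨m, mJ, ?_, fun k hk => ?_⟩
  · simp only [Set.mem_insert_iff]
    rintro (h | h)
    · omega
    · exact mI h
  · rw [← hm k hk, Set.mem_insert_iff]
    exact or_iff_right (by omega)

theorem grlt_insert {I : Set ℕ} {n : ℕ} (h : n ∉ I) : GRlt I (insert n I) := by
  refine grlt_iff.2 ⟨n, Or.inl rfl, h, fun k hk => ?_⟩
  rw [Set.mem_insert_iff]
  exact (or_iff_right (by omega)).symm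

section Length

variable {Λ : Type*} [Ring Λ] {M M' : Type*} [AddCommGroup M] [Module Λ M]
  [AddCommGroup M'] [Module Λ M']

theorem mlen_eq_length [IsArtinian Λ M] [IsNoetherian Λ M] :
    (mlen Λ M : ℕ∞) = Module.length Λ M := by
  have hf : IsFiniteLength Λ M := Module.length_ne_top_iff.1 Module.length_ne_top
  have h : ∃ s : CompositionSeries (Submodule Λ M), s.head = ⊥ ∧ s.last = ⊤ :=
    isFiniteLength_iff_exists_compositionSeries.1 hf
  rw [mlen, dif_pos h]
  exact Module.length_compositionSeries _ h.choose_spec.1 h.choose_spec.2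

theorem mlen_congr [IsArtinian Λ M] [IsNoetherian Λ M] (e : M ≃ₗ[Λ] M') :
    mlen Λ M = mlen Λ M' := by
  have := isArtinian_of_linearEquiv e
  have := isNoetherian_of_linearEquiv e
  have h := e.length_eq
  rw [← mlen_eq_length, ← mlen_eq_length] at h
  exact_mod_cast h

theorem mlen_pos [IsArtinian Λ M] [IsNoetherian Λ M] [Nontrivial M] : 0 < mlen Λ M := by
  have h := Module.length_pos (R := Λ) (M := M)
  rw [← mlen_eq_length] at h
  exact_mod_cast h

theorem mlen_le_of_injective [IsArtinian Λ M'] [IsNoetherian Λ M'] (f : M →ₗ[Λ] M')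
    (hf : Function.Injective f) : mlen Λ M ≤ mlen Λ M' := by
  have := isArtinian_of_injective f hf
  have := isNoetherian_of_injective f hf
  have h := Module.length_le_of_injective f hf
  rw [← mlen_eq_length, ← mlen_eq_length] at h
  exact_mod_cast h

theorem mlen_le_of_surjective [IsArtinian Λ M] [IsNoetherian Λ M] (f : M →ₗ[Λ] M')
    (hf : Function.Surjective f) : mlen Λ M' ≤ mlen Λ M := by
  have := isArtinian_of_surjective M f hf
  have := isNoetherian_of_surjective f (LinearMap.range_eq_top.2 hf)
  have h := Module.length_le_of_surjective f hf
  rw [← mlen_eq_length, ← mlen_eq_length] at h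
  exact_mod_cast h

theorem mlen_submodule_lt [IsArtinian Λ M] [IsNoetherian Λ M] {N : Submodule Λ M}
    (h : N ≠ ⊤) : mlen Λ N < mlen Λ M := by
  have h := Submodule.length_lt h
  rw [← mlen_eq_length, ← mlen_eq_length] at h
  exact_mod_cast h

theorem bijective_of_injective_of_mlen_le [IsArtinian Λ M'] [IsNoetherian Λ M']
    (f : M →ₗ[Λ] M') (hf : Function.Injective f) (h : mlen Λ M' ≤ mlen Λ M) :
    Function.Bijective f := by
  refine ⟨hf, ?_⟩
  rw [← LinearMap.range_eq_top]
  by_contra hne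
  have h₁ := mlen_submodule_lt hne
  have := isArtinian_of_injective f hf
  have := isNoetherian_of_injective f hf
  have h₂ := mlen_congr (LinearEquiv.ofInjective f hf)
  omega

theorem bijective_of_surjective_of_mlen_le [IsArtinian Λ M] [IsNoetherian Λ M]
    (f : M →ₗ[Λ] M') (hf : Function.Surjective f) (h : mlen Λ M ≤ mlen Λ M') :
    Function.Bijective f := by
  refine ⟨?_, hf⟩
  have h₀ := Module.length_eq_add_of_exact (LinearMap.ker f).subtype f
    (LinearMap.ker f).injective_subtype hf (LinearMap.exact_subtype_ker_map f)
  have := isArtinian_of_surjective M f hf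
  have := isNoetherian_of_surjective f (LinearMap.range_eq_top.2 hf)
  rw [← mlen_eq_length, ← mlen_eq_length, ← mlen_eq_length] at h₀
  have h₁ : mlen Λ M = mlen Λ (LinearMap.ker f) + mlen Λ M' := by exact_mod_cast h₀
  rw [← LinearMap.ker_eq_bot]
  by_contra hne
  have := Submodule.nontrivial_iff_ne_bot.2 hne
  have := mlen_pos (Λ := Λ) (M := LinearMap.ker f)
  omega

end Length

section Indecomposable

variable {Λ : Type*} [Ring Λ] {M M' : Type*} [AddCommGroup M] [Module Λ M]
  [AddCommGroup M'] [Module Λ M']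

theorem IsIndecomposableModule.nontrivial (h : IsIndecomposableModule Λ M) : Nontrivial M := by
  by_contra hn
  rw [not_nontrivial_iff_subsingleton] at hn
  exact h.1 (Subsingleton.elim _ _)

theorem IsIndecomposableModule.congr (e : M ≃ₗ[Λ] M') (h : IsIndecomposableModule Λ M) :
    IsIndecomposableModule Λ M' := by
  let o : Submodule Λ M' ≃o Submodule Λ M := (Submodule.orderIsoMapComap e).symm
  refine ⟨fun hb => h.1 ?_, ?_⟩
  · rw [← o.map_top, ← o.map_bot, hb]
  · rintro ⟨A, B, hA, hB, hAB⟩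
    refine h.2 ⟨o A, o B, ?_, ?_, hAB.map o⟩
    · exact fun h0 => hA (o.injective (h0.trans o.map_bot.symm))
    · exact fun h0 => hB (o.injective (h0.trans o.map_bot.symm))

theorem IsIndecomposableModule.eq_bot_or_eq_bot (h : IsIndecomposableModule Λ M)
    {A B : Submodule Λ M} (hAB : IsCompl A B) : A = ⊥ ∨ B = ⊥ := by
  by_contra hne
  push Not at hne
  exact h.2 ⟨A, B, hne.1, hne.2, hAB⟩

/-- If `Y → X → Y'` composes to a bijection and `X` is indecomposable and `Y ≠ 0`, then both
maps are bijections. -/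
theorem IsIndecomposableModule.bijective_of_comp_bijective {X Y Y' : Type*} [AddCommGroup X]
    [Module Λ X] [AddCommGroup Y] [Module Λ Y] [Nontrivial Y] [AddCommGroup Y'] [Module Λ Y']
    (h : IsIndecomposableModule Λ X) (f : Y →ₗ[Λ] X) (g : X →ₗ[Λ] Y')
    (hgf : Function.Bijective (g ∘ₗ f)) : Function.Bijective f ∧ Function.Bijective g := by
  have hinj : Function.Injective f := by
    have := hgf.1
    rw [LinearMap.coe_comp] at this
    exact this.of_comp
  have hsurj : Function.Surjective g := by
    have := hgf.2
    rw [LinearMap.coe_comp] at this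
    exact this.of_comp
  have hc : IsCompl (LinearMap.range f) (LinearMap.ker g) := by
    constructor
    · rw [Submodule.disjoint_def]
      rintro _ ⟨y, rfl⟩ hy
      have : y = 0 := hgf.1 (by simpa using hy)
      simp [this]
    · rw [codisjoint_iff, eq_top_iff]
      rintro x -
      obtain ⟨y, hy⟩ := hgf.2 (g x)
      refine Submodule.mem_sup.2 ⟨f y, ⟨y, rfl⟩, x - f y, ?_, by abel⟩
      rw [LinearMap.mem_ker, map_sub, ← hy, LinearMap.comp_apply, sub_self]
  rcases h.eq_bot_or_eq_bot hc with h0 | h0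
  · exfalso
    obtain ⟨y, hy⟩ := exists_ne (0 : Y)
    refine hy (hinj ?_)
    have : f y ∈ LinearMap.range f := ⟨y, rfl⟩
    rw [h0, Submodule.mem_bot] at this
    rw [this, map_zero]
  · have hg : Function.Injective g := LinearMap.ker_eq_bot.1 h0
    refine ⟨⟨hinj, fun x => ?_⟩, hg, hsurj⟩
    obtain ⟨y, hy⟩ := hgf.2 (g x)
    exact ⟨y, hg hy⟩

/-- Fitting's lemma: an endomorphism of an indecomposable module of finite length is nilpotent
or bijective. -/
theorem IsIndecomposableModule.isNilpotent_or_isUnit [IsArtinian Λ M] [IsNoetherian Λ M]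
    (h : IsIndecomposableModule Λ M) (f : Module.End Λ M) : IsNilpotent f ∨ IsUnit f := by
  obtain ⟨n, hn⟩ := Filter.eventually_atTop.1 (LinearMap.eventually_isCompl_ker_pow_range_pow f)
  have hc := hn (n + 1) (by omega)
  rcases h.eq_bot_or_eq_bot hc with h0 | h0
  · right
    rw [h0] at hc
    have htop : LinearMap.range (f ^ (n + 1)) = ⊤ := by
      simpa using hc.sup_eq_top
    have : IsUnit (f ^ (n + 1)) :=
      (Module.End.isUnit_iff _).2 ⟨LinearMap.ker_eq_bot.1 h0, LinearMap.range_eq_top.1 htop⟩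
    exact (isUnit_pow_iff (by omega)).1 this
  · left
    exact ⟨n + 1, LinearMap.range_eq_bot.1 h0⟩

theorem IsIndecomposableModule.isUnit_one_sub [IsArtinian Λ M] [IsNoetherian Λ M]
    (h : IsIndecomposableModule Λ M) {f : Module.End Λ M} (hf : ¬ IsUnit f) :
    IsUnit (1 - f) :=
  ((h.isNilpotent_or_isUnit f).resolve_right hf).isUnit_one_sub

end Indecomposable

/-- A module of finite length is a finite direct sum of indecomposable submodules; the
decomposition is expressed by endomorphisms with these images which add up to the identity. -/
theorem exists_sum_indecomposable_aux {Λ : Type*} [Ring Λ] (n : ℕ) :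
    ∀ (M : Type u) [AddCommGroup M] [Module Λ M] [IsArtinian Λ M] [IsNoetherian Λ M],
      mlen Λ M ≤ n →
      ∃ (ι : Type) (_ : Fintype ι) (p : ι → M →ₗ[Λ] M),
        (∀ k, IsIndecomposableModule Λ (LinearMap.range (p k))) ∧ ∑ k, p k = LinearMap.id := by
  induction n with
  | zero =>
    intro M _ _ _ _ h
    have hs : Subsingleton M := by
      by_contra hn
      rw [not_subsingleton_iff_nontrivial] at hn
      have := mlen_pos (Λ := Λ) (M := M)
      omega
    exact ⟨Empty, inferInstance, Empty.elim, fun k => k.elim, Subsingleton.elim _ _⟩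
  | succ n ih =>
    intro M _ _ _ _ h
    rcases subsingleton_or_nontrivial M with hs | hnt
    · exact ⟨Empty, inferInstance, Empty.elim, fun k => k.elim, Subsingleton.elim _ _⟩
    by_cases hM : IsIndecomposableModule Λ M
    · refine ⟨Unit, inferInstance, fun _ => LinearMap.id, fun _ => ?_, by simp⟩
      rw [LinearMap.range_id]
      exact hM.congr Submodule.topEquiv.symm
    · have hM' : ∃ A B : Submodule Λ M, A ≠ ⊥ ∧ B ≠ ⊥ ∧ IsCompl A B := by
        by_contra hne
        exact hM ⟨top_ne_bot, hne⟩
      obtain ⟨A, B, hA, hB, hAB⟩ := hM'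
      have hAt : A ≠ ⊤ := by
        rintro rfl
        exact hB (by simpa using hAB.inf_eq_bot)
      have hBt : B ≠ ⊤ := by
        rintro rfl
        exact hA (by simpa using hAB.inf_eq_bot)
      obtain ⟨a, _, pA, hpA, sA⟩ := ih A (by have := mlen_submodule_lt hAt; omega)
      obtain ⟨b, _, pB, hpB, sB⟩ := ih B (by have := mlen_submodule_lt hBt; omega)
      have key : ∀ {C D : Submodule Λ M} (hCD : IsCompl C D) (f : C →ₗ[Λ] C),
          IsIndecomposableModule Λ (LinearMap.range f) → IsIndecomposableModule Λ
            (LinearMap.range (C.subtype ∘ₗ f ∘ₗ Submodule.projectionOnto C D hCD)) := by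
        intro C D hCD f hf
        rw [LinearMap.range_comp, LinearMap.range_comp_of_range_eq_top _
          (Submodule.range_projectionOnto hCD)]
        exact hf.congr (Submodule.equivMapOfInjective C.subtype C.injective_subtype _)
      refine ⟨a ⊕ b, inferInstance, Sum.elim
        (fun i => A.subtype ∘ₗ pA i ∘ₗ Submodule.projectionOnto A B hAB)
        (fun i => B.subtype ∘ₗ pB i ∘ₗ Submodule.projectionOnto B A hAB.symm), ?_, ?_⟩
      · rintro (k | k)
        · exact key hAB (pA k) (hpA k)
        · exact key hAB.symm (pB k) (hpB k)
      · rw [Fintype.sum_sum_type]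
        ext x
        have hA' := congrArg Subtype.val
          (LinearMap.congr_fun sA (Submodule.projectionOnto A B hAB x))
        have hB' := congrArg Subtype.val
          (LinearMap.congr_fun sB (Submodule.projectionOnto B A hAB.symm x))
        simp only [LinearMap.sum_apply, Submodule.coe_sum, LinearMap.id_apply] at hA' hB'
        simp only [Sum.elim_inl, Sum.elim_inr, LinearMap.add_apply, LinearMap.sum_apply,
          LinearMap.comp_apply, Submodule.subtype_apply, LinearMap.id_apply]
        rw [hA', hB']
        simpa using Submodule.projection_add_projection_eq_self hAB x

theorem exists_sum_indecomposable {Λ : Type*} [Ring Λ] (M : Type u) [AddCommGroup M]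
    [Module Λ M] [IsArtinian Λ M] [IsNoetherian Λ M] :
    ∃ (ι : Type) (_ : Fintype ι) (p : ι → M →ₗ[Λ] M),
      (∀ k, IsIndecomposableModule Λ (LinearMap.range (p k))) ∧ ∑ k, p k = LinearMap.id :=
  exists_sum_indecomposable_aux _ M le_rfl

section Measure

variable {Λ : Type*} [Ring Λ] {M M' : Type*} [AddCommGroup M] [Module Λ M]
  [AddCommGroup M'] [Module Λ M']

theorem mlen_of_eq_top [IsArtinian Λ M] [IsNoetherian Λ M] {N : Submodule Λ M} (h : N = ⊤) :
    mlen Λ N = mlen Λ M := by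
  subst h
  exact mlen_congr Submodule.topEquiv

theorem grChainSets_subset_Iic [IsArtinian Λ M] [IsNoetherian Λ M] {S : Set ℕ}
    (hS : S ∈ grChainSets Λ M) : S ⊆ Set.Iic (mlen Λ M) := by
  obtain ⟨t, c, -, -, rfl⟩ := hS
  rintro _ ⟨i, rfl⟩
  exact mlen_le_of_injective (c i).subtype (c i).injective_subtype

theorem grChainSets_finite [IsArtinian Λ M] [IsNoetherian Λ M] : (grChainSets Λ M).Finite :=
  (Set.finite_Iic (mlen Λ M)).finite_subsets.subset fun _ => grChainSets_subset_Iic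

theorem singleton_mem_grChainSets (h : IsIndecomposableModule Λ M)
    [IsArtinian Λ M] [IsNoetherian Λ M] : {mlen Λ M} ∈ grChainSets Λ M := by
  refine ⟨0, fun _ => ⊤, fun i j hij => absurd hij (by omega),
    fun _ => h.congr Submodule.topEquiv.symm, ?_⟩
  simp [mlen_congr (Submodule.topEquiv (R := Λ) (M := M))]

theorem grMeasure_spec [IsArtinian Λ M] [IsNoetherian Λ M] (h : IsIndecomposableModule Λ M) :
    grMeasure Λ M ∈ grChainSets Λ M ∧ ∀ S ∈ grChainSets Λ M, GRle S (grMeasure Λ M) := by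
  have hex : ∃ S, S ∈ grChainSets Λ M ∧ ∀ S' ∈ grChainSets Λ M, GRle S' S :=
    exists_grle_max grChainSets_finite ⟨_, singleton_mem_grChainSets h⟩
  rw [grMeasure, dif_pos hex]
  exact hex.choose_spec

theorem grChainSets_mono [IsArtinian Λ M'] [IsNoetherian Λ M'] (f : M →ₗ[Λ] M')
    (hf : Function.Injective f) : grChainSets Λ M ⊆ grChainSets Λ M' := by
  have := isArtinian_of_injective f hf
  have := isNoetherian_of_injective f hf
  rintro _ ⟨t, c, hc, hi, rfl⟩
  refine ⟨t, fun i => (c i).map f, (Submodule.map_strictMono_of_injective hf).comp hc,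
    fun i => (hi i).congr (Submodule.equivMapOfInjective f hf _), ?_⟩
  congr 1
  ext i
  exact mlen_congr (Submodule.equivMapOfInjective f hf _)

theorem grMeasure_le_of_injective [IsArtinian Λ M'] [IsNoetherian Λ M'] (f : M →ₗ[Λ] M')
    (hf : Function.Injective f) (h : IsIndecomposableModule Λ M)
    (h' : IsIndecomposableModule Λ M') : GRle (grMeasure Λ M) (grMeasure Λ M') := by
  have := isArtinian_of_injective f hf
  have := isNoetherian_of_injective f hf
  exact (grMeasure_spec h').2 _ (grChainSets_mono f hf (grMeasure_spec h).1)

theorem grMeasure_congr [IsArtinian Λ M] [IsNoetherian Λ M] (e : M ≃ₗ[Λ] M')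
    (h : IsIndecomposableModule Λ M) : grMeasure Λ M = grMeasure Λ M' := by
  have := isArtinian_of_linearEquiv e
  have := isNoetherian_of_linearEquiv e
  exact (grMeasure_le_of_injective e.toLinearMap e.injective h (h.congr e)).antisymm
    (grMeasure_le_of_injective e.symm.toLinearMap e.symm.injective (h.congr e) h)

theorem insert_mlen_mem_grChainSets [IsArtinian Λ M] [IsNoetherian Λ M]
    (h : IsIndecomposableModule Λ M) {N : Submodule Λ M} (hN : N ≠ ⊤) {S : Set ℕ}
    (hS : S ∈ grChainSets Λ N) : insert (mlen Λ M) S ∈ grChainSets Λ M := by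
  obtain ⟨t, c, hc, hi, rfl⟩ := hS
  have hlt : ∀ i, (c i).map N.subtype < ⊤ := fun i =>
    (Submodule.map_subtype_le N (c i)).trans_lt (lt_top_iff_ne_top.2 hN)
  refine ⟨t + 1, Fin.snoc (α := fun _ => Submodule Λ M) (fun i => (c i).map N.subtype) ⊤,
    ?_, ?_, ?_⟩
  · intro i j hij
    refine Fin.lastCases (fun hij => ?_) (fun j hij => ?_) j hij
    · refine Fin.lastCases (fun hij => absurd hij (lt_irrefl _)) (fun i _ => ?_) i hij
      simpa using hlt i
    · have : i ≠ Fin.last (t + 1) := (hij.trans_le (Fin.le_last _)).ne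
      obtain ⟨i, rfl⟩ := Fin.exists_castSucc_eq.2 this
      simpa using (Submodule.map_strictMono_of_injective N.injective_subtype)
        (hc (Fin.castSucc_lt_castSucc_iff.1 hij))
  · intro i
    refine Fin.lastCases ?_ (fun i => ?_) i
    · rw [Fin.snoc_last]
      exact h.congr Submodule.topEquiv.symm
    · rw [Fin.snoc_castSucc]
      exact (hi i).congr (Submodule.equivMapOfInjective _ N.injective_subtype _)
  · have h₁ : ∀ i, mlen Λ (Fin.snoc (α := fun _ => Submodule Λ M)
        (fun i => (c i).map N.subtype) ⊤ (Fin.castSucc i) : Submodule Λ M) = mlen Λ (c i) := by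
      intro i
      rw [Fin.snoc_castSucc]
      exact (mlen_congr (Submodule.equivMapOfInjective _ N.injective_subtype _)).symm
    ext k
    simp only [Set.mem_insert_iff, Set.mem_range, Fin.exists_fin_succ' (n := t + 1), h₁]
    rw [mlen_of_eq_top (Fin.snoc_last _ _), or_comm, eq_comm]

theorem lt_mlen_of_mem_grMeasure [IsArtinian Λ M] [IsNoetherian Λ M]
    {N : Submodule Λ M} (hN : N ≠ ⊤) {S : Set ℕ}
    (hS : S ∈ grChainSets Λ N) : ∀ k ∈ S, k < mlen Λ M := fun _ hk =>
  (grChainSets_subset_Iic hS hk).trans_lt (mlen_submodule_lt hN)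

theorem grMeasure_submodule_lt [IsArtinian Λ M] [IsNoetherian Λ M]
    (h : IsIndecomposableModule Λ M) {N : Submodule Λ M} (hN : N ≠ ⊤)
    (hi : IsIndecomposableModule Λ N) : GRlt (grMeasure Λ N) (grMeasure Λ M) := by
  have hS := (grMeasure_spec hi).1
  refine (grlt_insert fun hm => ?_).trans_le
    ((grMeasure_spec h).2 _ (insert_mlen_mem_grChainSets h hN hS))
  exact lt_irrefl _ (lt_mlen_of_mem_grMeasure hN hS _ hm)

theorem grMeasure_lt_of_injective [IsArtinian Λ M'] [IsNoetherian Λ M'] (f : M →ₗ[Λ] M')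
    (hf : Function.Injective f) (hf' : ¬ Function.Bijective f) (h : IsIndecomposableModule Λ M)
    (h' : IsIndecomposableModule Λ M') : GRlt (grMeasure Λ M) (grMeasure Λ M') := by
  have := isArtinian_of_injective f hf
  have := isNoetherian_of_injective f hf
  let e := LinearEquiv.ofInjective f hf
  rw [grMeasure_congr e h]
  exact grMeasure_submodule_lt h'
    (fun ht => hf' ⟨hf, LinearMap.range_eq_top.1 ht⟩) (h.congr e)

theorem mlen_mem_grMeasure [IsArtinian Λ M] [IsNoetherian Λ M]
    (h : IsIndecomposableModule Λ M) : mlen Λ M ∈ grMeasure Λ M := by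
  obtain ⟨t, c, hc, hi, hS⟩ := (grMeasure_spec h).1
  by_cases ht : c (Fin.last t) = ⊤
  · rw [hS]
    exact ⟨Fin.last t, mlen_of_eq_top ht⟩
  · exfalso
    have hmem : grMeasure Λ M ∈ grChainSets Λ (c (Fin.last t)) := by
      refine ⟨t, fun i => (c i).comap (c (Fin.last t)).subtype, ?_, ?_, ?_⟩
      · intro i j hij
        have hle : ∀ i, c i ≤ c (Fin.last t) := fun i => hc.monotone (Fin.le_last i)
        refine lt_of_le_of_ne (Submodule.comap_mono (hc hij).le) fun he => (hc hij).ne ?_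
        have := congrArg (Submodule.map (c (Fin.last t)).subtype) he
        simpa [Submodule.map_comap_subtype, inf_eq_right.2 (hle _)] using this
      · exact fun i => (hi i).congr
          (Submodule.comapSubtypeEquivOfLe (hc.monotone (Fin.le_last i))).symm
      · rw [hS]
        congr 1
        ext i
        exact (mlen_congr (Submodule.comapSubtypeEquivOfLe (hc.monotone (Fin.le_last i)))).symm
    have h₁ := (grMeasure_spec h).2 _ (insert_mlen_mem_grChainSets h ht hmem)
    refine h₁.not_grlt (grlt_insert fun hm => ?_)
    exact lt_irrefl _ (lt_mlen_of_mem_grMeasure ht hmem _ hm)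

theorem le_mlen_of_mem_grMeasure [IsArtinian Λ M] [IsNoetherian Λ M]
    (h : IsIndecomposableModule Λ M) {k : ℕ} (hk : k ∈ grMeasure Λ M) : k ≤ mlen Λ M :=
  grChainSets_subset_Iic (grMeasure_spec h).1 hk

theorem mlen_eq_of_grMeasure_eq [IsArtinian Λ M] [IsNoetherian Λ M] [IsArtinian Λ M']
    [IsNoetherian Λ M'] (h : IsIndecomposableModule Λ M) (h' : IsIndecomposableModule Λ M')
    (he : grMeasure Λ M = grMeasure Λ M') : mlen Λ M = mlen Λ M' :=
  le_antisymm (le_mlen_of_mem_grMeasure h' (he ▸ mlen_mem_grMeasure h))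
    (le_mlen_of_mem_grMeasure h (he ▸ mlen_mem_grMeasure h'))

/-- The measure of a non-simple indecomposable module `M` is obtained from a chain in a proper
indecomposable submodule by adding `|M|`. -/
theorem exists_grMeasure_eq_insert [IsArtinian Λ M] [IsNoetherian Λ M]
    (h : IsIndecomposableModule Λ M) (hs : ¬ IsSimpleModule Λ M) :
    ∃ N : Submodule Λ M, N ≠ ⊤ ∧ IsIndecomposableModule Λ N ∧
      ∃ S ∈ grChainSets Λ N, grMeasure Λ M = insert (mlen Λ M) S := by
  have := h.nontrivial
  obtain ⟨t, c, hc, hi, hS⟩ := (grMeasure_spec h).1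
  have hlen := mlen_mem_grMeasure h
  rw [hS] at hlen
  obtain ⟨i, hi'⟩ := hlen
  have htop : ∀ i, mlen Λ (c i) = mlen Λ M → c i = ⊤ := fun i hi' => by
    by_contra hne
    exact (mlen_submodule_lt hne).ne hi'
  have hl : c (Fin.last t) = ⊤ := top_le_iff.1 ((htop i hi').ge.trans (hc.monotone (Fin.le_last i)))
  cases t with
  | zero =>
    exfalso
    obtain ⟨T, hT⟩ : ∃ T : Submodule Λ M, IsAtom T := IsAtomic.exists_atom _
    have hTs : IsSimpleModule Λ T := isSimpleModule_iff_isAtom.2 hT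
    have hTi : IsIndecomposableModule Λ T := by
      have := IsSimpleModule.nontrivial Λ T
      refine ⟨(top_ne_bot : (⊤ : Submodule Λ T) ≠ ⊥), ?_⟩
      rintro ⟨A, B, hA, hB, hAB⟩
      have hA := (eq_bot_or_eq_top A).resolve_left hA
      have hB := (eq_bot_or_eq_top B).resolve_left hB
      rw [hA, hB] at hAB
      have h0 : (⊤ : Submodule Λ T) = ⊥ := by simpa using hAB.inf_eq_bot
      exact top_ne_bot h0
    have hTt : T ≠ ⊤ := by
      rintro rfl
      exact hs ((Submodule.topEquiv (R := Λ) (M := M)).isSimpleModule_iff.1 hTs)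
    have hins := (grMeasure_spec h).2 _
      (insert_mlen_mem_grChainSets h hTt (singleton_mem_grChainSets hTi))
    have hμ : grMeasure Λ M = {mlen Λ M} := by
      rw [hS]
      ext k
      have : mlen Λ (c 0) = mlen Λ M := mlen_of_eq_top hl
      simp [this, eq_comm]
    rw [hμ, Set.pair_comm] at hins
    refine hins.not_grlt (grlt_iff.2 ⟨mlen Λ T, by simp, ?_, fun k hk => ?_⟩)
    · exact (mlen_submodule_lt hTt).ne
    · have := mlen_submodule_lt hTt
      simp only [Set.mem_singleton_iff, Set.mem_insert_iff]
      omega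
  | succ t =>
    have hle : ∀ i : Fin (t + 1), c i.castSucc ≤ c (Fin.last t).castSucc := fun i =>
      hc.monotone (Fin.castSucc_le_castSucc_iff.2 (Fin.le_last i))
    refine ⟨c (Fin.last t).castSucc, ?_, hi _, Set.range fun i : Fin (t + 1) =>
      mlen Λ (c i.castSucc), ⟨t, fun i => (c i.castSucc).comap (c (Fin.last t).castSucc).subtype,
        ?_, ?_, ?_⟩, ?_⟩
    · rw [← hl]
      exact (hc (Fin.castSucc_lt_last _)).ne
    · intro i j hij
      have hij' := hc (Fin.castSucc_lt_castSucc_iff.2 hij)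
      refine lt_of_le_of_ne (Submodule.comap_mono hij'.le) fun he => hij'.ne ?_
      have := congrArg (Submodule.map (c (Fin.last t).castSucc).subtype) he
      simpa [Submodule.map_comap_subtype, inf_eq_right.2 (hle _)] using this
    · exact fun i => (hi _).congr (Submodule.comapSubtypeEquivOfLe (hle i)).symm
    · congr 1
      ext i
      exact (mlen_congr (Submodule.comapSubtypeEquivOfLe (hle i))).symm
    · rw [hS]
      ext k
      simp only [Set.mem_insert_iff, Set.mem_range, Fin.exists_fin_succ' (n := t + 1)]
      have : mlen Λ (c (Fin.last (t + 1))) = mlen Λ M := mlen_of_eq_top hl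
      rw [this, or_comm, eq_comm]

end Measure

/-- Gabriel's main property: if `X` is cogenerated by a family of indecomposable modules `Y i`
(all of finite length), then either one of the given maps `X → Y i` is an isomorphism, or
`μ(X) ≺ μ(Y i)` for some `i`. -/
theorem gabriel_main_property {Λ : Type*} [Ring Λ] (n : ℕ) :
    ∀ (X : Type u) [AddCommGroup X] [Module Λ X] [IsArtinian Λ X] [IsNoetherian Λ X],
      mlen Λ X = n → IsIndecomposableModule Λ X →
      ∀ (ι : Type u) (Y : ι → Type u) [∀ i, AddCommGroup (Y i)] [∀ i, Module Λ (Y i)]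
        [∀ i, IsArtinian Λ (Y i)] [∀ i, IsNoetherian Λ (Y i)] (g : ∀ i, X →ₗ[Λ] Y i),
        (∀ i, IsIndecomposableModule Λ (Y i)) → (∀ x, (∀ i, g i x = 0) → x = 0) →
        (∃ i, Function.Bijective (g i)) ∨ ∃ i, GRlt (grMeasure Λ X) (grMeasure Λ (Y i)) := by
  induction n using Nat.strong_induction_on with
  | _ n ih =>
  intro X _ _ _ _ hn hX ι Y _ _ _ _ g hY hg
  have := hX.nontrivial
  by_cases hinj : ∃ i, Function.Injective (g i)
  · obtain ⟨i, hi⟩ := hinj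
    by_cases hb : Function.Bijective (g i)
    · exact Or.inl ⟨i, hb⟩
    · exact Or.inr ⟨i, grMeasure_lt_of_injective _ hi hb hX (hY i)⟩
  push Not at hinj
  right
  have hs : ¬ IsSimpleModule Λ X := by
    intro hs
    obtain ⟨x, hx⟩ := exists_ne (0 : X)
    refine hx (hg x fun i => ?_)
    have : g i = 0 := (LinearMap.injective_or_eq_zero (g i)).resolve_left (hinj i)
    rw [this, LinearMap.zero_apply]
  obtain ⟨N, hNt, hN, S, hS, hμ⟩ := exists_grMeasure_eq_insert hX hs
  choose κ hκ p hp hsum using fun i => exists_sum_indecomposable (Λ := Λ) (LinearMap.range (g i))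
  have hlt : ∀ i (k : κ i), mlen Λ (LinearMap.range (p i k)) < mlen Λ X := by
    intro i k
    have h₁ := mlen_le_of_injective (LinearMap.range (p i k)).subtype
      (Submodule.injective_subtype _)
    have h₂ := mlen_le_of_surjective _ (g i).surjective_rangeRestrict
    by_contra hge
    exact hinj i ((g i).ker_rangeRestrict ▸ LinearMap.ker_eq_bot.2
      (bijective_of_surjective_of_mlen_le _ (g i).surjective_rangeRestrict (by omega)).1
        |> LinearMap.ker_eq_bot.1)
  have hj : ∀ x : N, (∀ k : ULift.{u} (Σ i, κ i), (((p k.down.1 k.down.2).rangeRestrict ∘ₗ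
      (g k.down.1).rangeRestrict) ∘ₗ N.subtype) x = 0) → x = 0 := by
    intro x hx
    have : (x : X) = 0 := hg _ fun i => by
      have h₁ := LinearMap.congr_fun (hsum i) ((g i).rangeRestrict x)
      have h₂ : ∀ k, p i k ((g i).rangeRestrict x) = 0 := fun k =>
        congrArg Subtype.val (hx ⟨⟨i, k⟩⟩)
      simp only [LinearMap.sum_apply, h₂, Finset.sum_const_zero, LinearMap.id_apply] at h₁
      exact congrArg Subtype.val h₁.symm
    exact Subtype.ext this
  rcases ih (mlen Λ N) (hn ▸ mlen_submodule_lt hNt) N rfl hN (ULift.{u} (Σ i, κ i))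
    (fun k => LinearMap.range (p k.down.1 k.down.2))
    (fun k => ((p k.down.1 k.down.2).rangeRestrict ∘ₗ (g k.down.1).rangeRestrict) ∘ₗ N.subtype)
    (fun k => hp _ _) hj with ⟨k, hk⟩ | ⟨k, hk⟩
  · exfalso
    have := hN.nontrivial
    have hb := (hX.bijective_of_comp_bijective N.subtype _ hk).1
    exact hNt (by simpa using LinearMap.range_eq_top.2 hb.2)
  · refine ⟨k.down.1, ?_⟩
    have h₁ : GRlt S (grMeasure Λ (LinearMap.range (p k.down.1 k.down.2))) :=
      ((grMeasure_spec hN).2 _ hS).trans_lt hk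
    rw [hμ]
    refine (h₁.insert_of_forall_lt fun m hm =>
      (le_mlen_of_mem_grMeasure (hp _ _) hm).trans_lt (hlt _ _)).trans_le ?_
    exact grMeasure_le_of_injective
      ((LinearMap.range (g k.down.1)).subtype ∘ₗ (LinearMap.range (p k.down.1 k.down.2)).subtype)
      ((Submodule.injective_subtype _).comp (Submodule.injective_subtype _)) (hp _ _) (hY _)

section Matlis

variable {R : Type u} [CommRing R]

/-- An injective module `J` whose associated contravariant hom functor is a duality on finitely
generated modules. -/
structure IsDualizingModule (R : Type u) [CommRing R] (J : Type u) [AddCommGroup J]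
    [Module R J] : Prop where
  injective : Module.Injective R J
  finite_dual : ∀ (V : Type u) [AddCommGroup V] [Module R V] [Module.Finite R V],
    Module.Finite R (V →ₗ[R] J)
  cogenerates : ∀ (V : Type u) [AddCommGroup V] [Module R V] (v : V), v ≠ 0 →
    ∃ c : V →ₗ[R] J, c v ≠ 0
  reflexive : ∀ (V : Type u) [AddCommGroup V] [Module R V] [Module.Finite R V]
    (F : (V →ₗ[R] J) →ₗ[R] J), ∃ v, ∀ c, F c = c v

/-- A submodule of an injective module is contained in an injective essential extension. -/
theorem exists_injective_essential (J₀ : Type u) [AddCommGroup J₀] [Module R J₀]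
    [hJ : Module.Injective R J₀] (S : Submodule R J₀) :
    ∃ K : Submodule R J₀, S ≤ K ∧ (∀ x ∈ K, x ≠ 0 → ∃ r : R, r • x ∈ S ∧ r • x ≠ 0) ∧
      Module.Injective R K := by
  obtain ⟨K, hSK, hK⟩ := zorn_le_nonempty₀
    {K : Submodule R J₀ | S ≤ K ∧ ∀ x ∈ K, x ≠ 0 → ∃ r : R, r • x ∈ S ∧ r • x ≠ 0}
    (fun c hc hch y hy => by
      refine ⟨sSup c, ⟨(hc hy).1.trans (le_sSup hy), fun x hx hx0 => ?_⟩, fun z => le_sSup⟩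
      obtain ⟨z, hz, hxz⟩ := (Submodule.mem_sSup_of_directed ⟨y, hy⟩ hch.directedOn).1 hx
      exact (hc hz).2 x hxz hx0)
    S ⟨le_rfl, fun x hx hx0 => ⟨1, by simpa using hx, by simpa using hx0⟩⟩
  obtain ⟨C, -, hC⟩ := zorn_le_nonempty₀ {C : Submodule R J₀ | ∀ x ∈ C, x ∈ K → x = 0}
    (fun c hc hch y hy => by
      refine ⟨sSup c, fun x hx hxK => ?_, fun z => le_sSup⟩
      obtain ⟨z, hz, hxz⟩ := (Submodule.mem_sSup_of_directed ⟨y, hy⟩ hch.directedOn).1 hx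
      exact hc hz x hxz hxK)
    ⊥ (fun x hx _ => by simpa using hx)
  have hi : Function.Injective (C.mkQ ∘ₗ K.subtype) := by
    rw [← LinearMap.ker_eq_bot, LinearMap.ker_eq_bot']
    intro x hx
    exact Subtype.ext (hC.prop _ ((Submodule.Quotient.mk_eq_zero C).1 hx) x.2)
  have hess : ∀ x : J₀, x ∉ C → ∃ r : R, ∃ s ∈ S, s ≠ 0 ∧ r • x - s ∈ C := by
    intro x hx
    have h₁ : ¬ ∀ y ∈ C ⊔ Submodule.span R {x}, y ∈ K → y = 0 := fun h₁ =>
      hx (hC.le_of_ge h₁ le_sup_left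
          (Submodule.mem_sup_right (Submodule.mem_span_singleton_self x)))
    push Not at h₁
    obtain ⟨y, hy, hyK, hy0⟩ := h₁
    obtain ⟨c, hc, z, hz, rfl⟩ := Submodule.mem_sup.1 hy
    obtain ⟨r, rfl⟩ := Submodule.mem_span_singleton.1 hz
    obtain ⟨t, ht, ht0⟩ := hK.prop.2 _ hyK hy0
    refine ⟨t * r, _, ht, ht0, ?_⟩
    rw [smul_add, smul_smul, sub_add_cancel_right]
    exact C.neg_mem (C.smul_mem _ hc)
  obtain ⟨g, hg⟩ := hJ.out (C.mkQ ∘ₗ K.subtype) hi K.subtype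
  have hg' : ∀ s ∈ S, g (C.mkQ s) = s := fun s hs => hg ⟨s, hSK hs⟩
  have hrange : LinearMap.range g ≤ K := by
    refine hK.le_of_ge ⟨fun s hs => ⟨_, hg' s hs⟩, ?_⟩ fun k hk => ⟨_, hg ⟨k, hk⟩⟩
    rintro _ ⟨x, rfl⟩ hx0
    obtain ⟨x, rfl⟩ := C.mkQ_surjective x
    have hxC : x ∉ C := fun h => hx0 (by
      rw [show C.mkQ x = 0 from (Submodule.Quotient.mk_eq_zero C).2 h, map_zero])
    obtain ⟨r, s, hs, hs0, hrs⟩ := hess x hxC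
    have : r • g (C.mkQ x) = s := by
      rw [← map_smul, ← map_smul, ← hg' s hs]
      exact congrArg g ((Submodule.Quotient.eq C).2 hrs)
    exact ⟨r, this ▸ hs, this ▸ hs0⟩
  refine ⟨K, hSK, hK.prop.2, ⟨fun X Y _ _ _ _ f hf q => ?_⟩⟩
  obtain ⟨h, hh⟩ := hJ.out f hf (K.subtype ∘ₗ q)
  refine ⟨(g.codRestrict K fun x => hrange ⟨x, rfl⟩) ∘ₗ C.mkQ ∘ₗ h, fun x => Subtype.ext ?_⟩
  have := hg (q x)
  simp only [LinearMap.comp_apply, hh, LinearMap.codRestrict_apply] at this ⊢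
  exact this

/-- The elements of `∏ R/n` annihilated by a maximal ideal `m` form a module of length at most
one. -/
theorem length_hom_simple_le {J : Type u} [AddCommGroup J] [Module R J]
    (i : ((m : MaximalSpectrum R) → R ⧸ m.asIdeal) →ₗ[R] J) (hi : Function.Injective i)
    (hess : ∀ x : J, x ≠ 0 → ∃ r : R, r • x ∈ LinearMap.range i ∧ r • x ≠ 0)
    (V : Type u) [AddCommGroup V] [Module R V] [IsSimpleModule R V] :
    Module.length R (V →ₗ[R] J) ≤ 1 := by
  have := IsSimpleModule.nontrivial R V
  obtain ⟨v, hv⟩ := exists_ne (0 : V)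
  have hspan : ∀ w : V, ∃ r : R, r • v = w := fun w => by
    have : w ∈ Submodule.span R {v} := by
      rw [(eq_bot_or_eq_top (Submodule.span R {v})).resolve_left (by simpa using hv)]
      trivial
    exact Submodule.mem_span_singleton.1 this
  have hmax : Ideal.IsMaximal (LinearMap.ker (LinearMap.toSpanSingleton R V v)) :=
    IsSimpleModule.ker_toSpanSingleton_isMaximal R hv
  let m : MaximalSpectrum R := ⟨_, hmax⟩
  have hm : ∀ r, r ∈ m.asIdeal ↔ r • v = 0 := fun r => by simp [m]
  have hrange : ∀ f : V →ₗ[R] J, ∃ s, i s = f v := by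
    intro f
    by_cases h0 : f v = 0
    · exact ⟨0, by simp [h0]⟩
    obtain ⟨r, ⟨s, hs⟩, hr⟩ := hess _ h0
    have hrv : r • v ≠ 0 := fun h => hr (by rw [← map_smul, h, map_zero])
    obtain ⟨t, ht⟩ : ∃ t : R, t • r • v = v := by
      have : v ∈ Submodule.span R {r • v} := by
        rw [(eq_bot_or_eq_top (Submodule.span R {r • v})).resolve_left (by simpa using hrv)]
        trivial
      exact Submodule.mem_span_singleton.1 this
    refine ⟨t • s, ?_⟩
    rw [map_smul, hs, ← map_smul, ← map_smul, ht]
  let e := LinearEquiv.ofInjective i hi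
  let ev : (V →ₗ[R] J) →ₗ[R] LinearMap.range i :=
    { toFun := fun f => ⟨f v, hrange f⟩
      map_add' := fun f g => rfl
      map_smul' := fun r f => rfl }
  let q : (V →ₗ[R] J) →ₗ[R] R ⧸ m.asIdeal :=
    LinearMap.proj m ∘ₗ e.symm.toLinearMap ∘ₗ ev
  have hq : Function.Injective q := by
    rw [← LinearMap.ker_eq_bot, LinearMap.ker_eq_bot']
    intro f hf
    have hs : i (e.symm (ev f)) = f v := congrArg Subtype.val (e.apply_symm_apply (ev f))
    have h0 : e.symm (ev f) = 0 := by
      funext n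
      by_cases hn : n = m
      · rw [hn]
        exact hf
      · have hne : m.asIdeal ⊔ n.asIdeal = ⊤ :=
          Ideal.isCoprime_iff_sup_eq.1 (Ideal.isCoprime_of_isMaximal
            (fun h => hn (MaximalSpectrum.ext h.symm)))
        obtain ⟨a, ha, b, hb, hab⟩ := Submodule.mem_sup.1
          (show (1 : R) ∈ m.asIdeal ⊔ n.asIdeal by rw [hne]; trivial)
        have h₁ : a • e.symm (ev f) = 0 := hi (by
          rw [map_smul, hs, ← map_smul, (hm a).1 ha, map_zero, map_zero])
        have h₂ : b • (e.symm (ev f)) n = 0 := by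
          obtain ⟨x, hx⟩ := Ideal.Quotient.mk_surjective ((e.symm (ev f)) n)
          rw [← hx]
          exact Ideal.Quotient.eq_zero_iff_mem.2 (n.asIdeal.mul_mem_right _ hb)
        have h₃ : a • (e.symm (ev f)) n = 0 := congrFun h₁ n
        rw [← one_smul R ((e.symm (ev f)) n), ← hab, add_smul, h₂, h₃, add_zero]
        rfl
    rw [h0, map_zero] at hs
    ext w
    obtain ⟨r, rfl⟩ := hspan w
    rw [map_smul, ← hs, smul_zero, LinearMap.zero_apply]
  have : IsSimpleModule R (R ⧸ m.asIdeal) :=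
    isSimpleModule_iff_isCoatom.2 (Ideal.isMaximal_def.1 m.isMaximal)
  exact (Module.length_le_of_injective q hq).trans_eq (Module.length_eq_one R _)

theorem length_hom_le {J : Type u} [AddCommGroup J] [Module R J] [hJ : Module.Injective R J]
    (hs : ∀ (V : Type u) [AddCommGroup V] [Module R V] [IsSimpleModule R V],
      Module.length R (V →ₗ[R] J) ≤ 1)
    (V : Type u) [AddCommGroup V] [Module R V] (hV : IsFiniteLength R V) :
    Module.length R (V →ₗ[R] J) ≤ Module.length R V := by
  induction hV with
  | of_subsingleton =>
    rw [Module.length_eq_zero]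
    exact zero_le
  | @of_simple_quotient M _ _ N _ _ ih =>
    have h₁ := Module.length_eq_add_of_exact (LinearMap.lcomp R J N.mkQ)
      (LinearMap.lcomp R J N.subtype)
      (fun f g h => by
        ext x
        exact LinearMap.congr_fun h x)
      (fun f => by
        obtain ⟨h, hh⟩ := hJ.out N.subtype N.injective_subtype f
        exact ⟨h, LinearMap.ext hh⟩)
      (fun f => by
        constructor
        · intro h
          refine ⟨N.liftQ f fun x hx => LinearMap.congr_fun h ⟨x, hx⟩, ?_⟩
          ext x
          rfl
        · rintro ⟨f, rfl⟩
          ext x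
          simpa using congrArg f ((Submodule.Quotient.mk_eq_zero N).2 x.2))
    have h₂ := Module.length_eq_add_of_exact N.subtype N.mkQ N.injective_subtype
      N.mkQ_surjective (LinearMap.exact_subtype_mkQ N)
    rw [h₁, h₂, add_comm, Module.length_eq_one R (M ⧸ N)]
    exact add_le_add ih (hs _)

/-- A commutative artinian ring has a dualizing module. -/
theorem exists_isDualizingModule (R : Type u) [CommRing R] [IsArtinianRing R] :
    ∃ (J : Type u) (_ : AddCommGroup J) (_ : Module R J), IsDualizingModule R J := by
  let S := (m : MaximalSpectrum R) → R ⧸ m.asIdeal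
  obtain ⟨P⟩ := CategoryTheory.EnoughInjectives.presentation (ModuleCat.of R S)
  have hPi : CategoryTheory.Injective (ModuleCat.of R P.J) := P.injective
  have hP : Module.Injective R P.J := Module.injective_module_of_injective_object R P.J
  have hf : Function.Injective P.f.hom := (ModuleCat.mono_iff_injective P.f).1 P.mono
  obtain ⟨K, hSK, hess, hK⟩ := exists_injective_essential P.J (LinearMap.range P.f.hom)
  let i : S →ₗ[R] K := P.f.hom.codRestrict K fun x => hSK ⟨x, rfl⟩
  have hi : Function.Injective i := fun x y h => hf (congrArg Subtype.val h)
  have hs := length_hom_simple_le i hi (fun x hx => by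
    obtain ⟨r, ⟨s, hs⟩, hr⟩ := hess x x.2 (fun h => hx (Subtype.ext h))
    exact ⟨r, ⟨s, Subtype.ext hs⟩, fun h => hr (congrArg Subtype.val h)⟩)
  have hlen := length_hom_le (J := K) (fun V => hs V)
  have hfl : ∀ (V : Type u) [AddCommGroup V] [Module R V] [Module.Finite R V],
      IsFiniteLength R V := fun V _ _ _ =>
    isFiniteLength_iff_isNoetherian_isArtinian.2 ⟨inferInstance, inferInstance⟩
  have hfin : ∀ (V : Type u) [AddCommGroup V] [Module R V] [Module.Finite R V],
      IsFiniteLength R (V →ₗ[R] K) := fun V _ _ _ => by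
    rw [← Module.length_ne_top_iff]
    exact ne_top_of_le_ne_top (Module.length_ne_top_iff.2 (hfl V)) (hlen V (hfl V))
  have hcog : ∀ (V : Type u) [AddCommGroup V] [Module R V] (v : V), v ≠ 0 →
      ∃ c : V →ₗ[R] K, c v ≠ 0 := by
    classical
    intro V _ _ v hv
    let f := LinearMap.toSpanSingleton R V v
    have hker : LinearMap.ker f ≠ ⊤ := fun h => hv (by
      have : (1 : R) ∈ LinearMap.ker f := h ▸ Submodule.mem_top
      simpa [f] using this)
    obtain ⟨m, hm, hle⟩ := Ideal.exists_le_maximal _ hker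
    let g : (R ⧸ LinearMap.ker f) →ₗ[R] K :=
      i ∘ₗ LinearMap.single R _ (⟨m, hm⟩ : MaximalSpectrum R) ∘ₗ Submodule.factor hle
    obtain ⟨h, hh⟩ := hK.out ((LinearMap.ker f).liftQ f le_rfl)
      (LinearMap.ker_eq_bot.1 (Submodule.ker_liftQ_eq_bot _ _ _ le_rfl)) g
    refine ⟨h, ?_⟩
    have h₁ := hh (Submodule.Quotient.mk 1)
    rw [Submodule.liftQ_apply] at h₁
    rw [LinearMap.toSpanSingleton_apply, one_smul] at h₁
    rw [h₁]
    intro h0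
    have h₂ := congrFun (hi (h0.trans (map_zero i).symm)) (⟨m, hm⟩ : MaximalSpectrum R)
    have h₃ : (Submodule.Quotient.mk (1 : R) : R ⧸ m) = 0 :=
      (Pi.single_eq_same (M := fun n : MaximalSpectrum R => R ⧸ n.asIdeal) ⟨m, hm⟩
        (Submodule.factor hle (Submodule.Quotient.mk 1))).symm.trans h₂
    exact hm.ne_top ((Ideal.eq_top_iff_one m).2 ((Submodule.Quotient.mk_eq_zero m).1 h₃))
  refine ⟨K, inferInstance, inferInstance, hK, ?_, hcog, ?_⟩
  · intro V _ _ _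
    have := (isFiniteLength_iff_isNoetherian_isArtinian.1 (hfin V)).1
    infer_instance
  · intro V _ _ _ F
    have h₁ := hfin V
    have h₂ := isFiniteLength_iff_isNoetherian_isArtinian.1 h₁
    have : IsNoetherian R (V →ₗ[R] K) := h₂.1
    have h₃ : Module.length R ((V →ₗ[R] K) →ₗ[R] K) ≤ Module.length R V :=
      (hlen _ h₁).trans (hlen _ (hfl V))
    have h₄ := isFiniteLength_iff_isNoetherian_isArtinian.1 (hfin (V →ₗ[R] K))
    have := h₄.1
    have := h₄.2
    let ev : V →ₗ[R] ((V →ₗ[R] K) →ₗ[R] K) := LinearMap.flip LinearMap.id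
    have hb := bijective_of_injective_of_mlen_le ev (by
        rw [← LinearMap.ker_eq_bot, LinearMap.ker_eq_bot']
        intro v hv
        by_contra h0
        obtain ⟨c, hc⟩ := hcog V v h0
        exact hc (LinearMap.congr_fun hv c)) (by
        rw [← mlen_eq_length, ← mlen_eq_length] at h₃
        exact_mod_cast h₃)
    obtain ⟨v, hv⟩ := hb.2 F
    exact ⟨v, fun c => by rw [← hv]; rfl⟩

end Matlis

section AlmostSplit

variable {R : Type u} [CommRing R] {Λ : Type u} [Ring Λ] [Algebra R Λ]

/-- The endomorphism ring of an indecomposable module has a functional whose support consists of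
automorphisms, and which does not vanish at the identity. -/
theorem IsIndecomposableModule.exists_functional {J : Type u} [AddCommGroup J] [Module R J]
    (hJ : IsDualizingModule R J) {N : Type u} [AddCommGroup N] [Module R N] [Module Λ N]
    [IsScalarTower R Λ N] [IsArtinian Λ N] [IsNoetherian Λ N] (hN : IsIndecomposableModule Λ N) :
    ∃ φ : Module.End Λ N →ₗ[R] J, φ 1 ≠ 0 ∧ ∀ f, φ f ≠ 0 → IsUnit f := by
  have := hN.nontrivial
  let U : Submodule R (Module.End Λ N) :=
    { carrier := {f | ¬ IsUnit f}
      zero_mem' := not_isUnit_zero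
      add_mem' := by
        rintro a b ha hb ⟨u, hu⟩
        have ha' : ¬ IsUnit (↑u⁻¹ * a) := by simpa using ha
        have h := hN.isUnit_one_sub ha'
        have hb' : 1 - ↑u⁻¹ * a = ↑u⁻¹ * b := by
          rw [← u.inv_mul, hu, mul_add, add_sub_cancel_left]
        rw [hb'] at h
        exact hb (by simpa using h)
      smul_mem' := by
        intro r f hf hu
        have hc : r • f = algebraMap R (Module.End Λ N) r * f := Algebra.smul_def r f
        rw [hc] at hu
        exact hf ((show Commute _ _ from Algebra.commutes r f).isUnit_mul_iff.1 hu).2 }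
  obtain ⟨c, hc⟩ := hJ.cogenerates (Module.End Λ N ⧸ U) (U.mkQ 1) (fun h =>
    (Submodule.Quotient.mk_eq_zero U).1 h isUnit_one)
  refine ⟨c ∘ₗ U.mkQ, hc, fun f hf => ?_⟩
  by_contra hu
  exact hf (by
    rw [LinearMap.comp_apply, show U.mkQ f = 0 from (Submodule.Quotient.mk_eq_zero U).2 hu,
      map_zero])

theorem isUnit_comp_splits {N X : Type*} [AddCommGroup N] [Module Λ N] [AddCommGroup X]
    [Module Λ X] {h : N →ₗ[Λ] X} {u : X →ₗ[Λ] N} (hu : IsUnit (u ∘ₗ h : Module.End Λ N)) :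
    ∃ r : X →ₗ[Λ] N, r ∘ₗ h = LinearMap.id := by
  obtain ⟨v, hv⟩ := hu
  refine ⟨(↑v⁻¹ : Module.End Λ N) ∘ₗ u, ?_⟩
  rw [LinearMap.comp_assoc, ← hv]
  exact v.inv_mul

theorem isUnit_comp_splits' {N X : Type*} [AddCommGroup N] [Module Λ N] [AddCommGroup X]
    [Module Λ X] {h : X →ₗ[Λ] N} {u : N →ₗ[Λ] X} (hu : IsUnit (h ∘ₗ u : Module.End Λ N)) :
    ∃ r : N →ₗ[Λ] X, h ∘ₗ r = LinearMap.id := by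
  obtain ⟨v, hv⟩ := hu
  refine ⟨u ∘ₗ (↑v⁻¹ : Module.End Λ N), ?_⟩
  rw [← LinearMap.comp_assoc, ← hv]
  exact v.mul_inv

variable (R) in
/-- Restriction of scalars turns a `Λ`-module into an `R`-module. -/
theorem exists_restrictScalars (X : Type u) [AddCommGroup X] [Module Λ X] :
    ∃ _ : Module R X, IsScalarTower R Λ X := by
  let _ := Module.compHom X (algebraMap R Λ)
  exact ⟨inferInstance, ⟨fun r l x => by
    rw [Algebra.smul_def, mul_smul]
    rfl⟩⟩

theorem linearMap_sum_single {n : ℕ} {V W : Type*} [AddCommGroup V] [Module R V] [AddCommGroup W]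
    [Module R W] (F : (Fin n → V) →ₗ[R] W) (x : Fin n → V) :
    F x = ∑ i, F (Pi.single i (x i)) := by
  rw [← map_sum, Finset.univ_sum_single]

/-- Every indecomposable module `N` is the source of a left almost split map. -/
theorem exists_left_almost_split [IsArtinianRing R] [Module.Finite R Λ]
    {J : Type u} [AddCommGroup J] [Module R J]
    (hJ : IsDualizingModule R J) (N : Type u) [AddCommGroup N] [Module Λ N]
    [Module.Finite Λ N] (hN : IsIndecomposableModule Λ N) :
    ∃ (E : Type u) (_ : AddCommGroup E) (_ : Module Λ E) (_ : Module.Finite Λ E)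
      (s : N →ₗ[Λ] E), (¬ ∃ r : E →ₗ[Λ] N, r ∘ₗ s = LinearMap.id) ∧
      ∀ (X : Type u) [AddCommGroup X] [Module Λ X] [Module.Finite Λ X] (h : N →ₗ[Λ] X),
        (¬ ∃ r : X →ₗ[Λ] N, r ∘ₗ h = LinearMap.id) → ∃ h' : E →ₗ[Λ] X, h' ∘ₗ s = h := by
  classical
  obtain ⟨_, _⟩ := exists_restrictScalars R (Λ := Λ) N
  have : Module.Finite R N := Module.Finite.trans Λ N
  have : IsArtinian Λ N := isArtinian_of_tower R inferInstance
  have : IsNoetherian Λ N := isNoetherian_of_tower R inferInstance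
  obtain ⟨φ, hφ1, hφ⟩ := hN.exists_functional hJ
  have := hJ.finite_dual N
  obtain ⟨n, q, hq⟩ := Module.Finite.exists_fin (R := R) (M := N →ₗ[R] J)
  have hsep : ∀ x y : N, (∀ b : N →ₗ[R] J, b x = b y) → x = y := fun x y h => by
    by_contra hne
    obtain ⟨c, hc⟩ := hJ.cogenerates N (x - y) (sub_ne_zero.2 hne)
    exact hc (by rw [map_sub, h c, sub_self])
  have hsep' : ∀ x : N, (∀ i, q i x = 0) → x = 0 := fun x h => hsep x 0 fun b => by
    have hb : b ∈ Submodule.span R (Set.range q) := by rw [hq]; trivial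
    rw [map_zero]
    induction hb using Submodule.span_induction with
    | mem b hb => obtain ⟨i, rfl⟩ := hb; exact h i
    | zero => rfl
    | add b c _ _ hb hc => rw [LinearMap.add_apply, hb, hc, add_zero]
    | smul r b _ hb => rw [LinearMap.smul_apply, hb, smul_zero]
  let ι : Module.End Λ N →ₗ[R] (Fin n → N →ₗ[R] J) :=
    { toFun := fun f i => q i ∘ₗ f.restrictScalars R
      map_add' := fun f g => by
        ext i x
        exact map_add (q i) _ _
      map_smul' := fun r f => by
        ext i x
        exact map_smul (q i) _ _ }
  have hι : Function.Injective ι := by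
    rw [← LinearMap.ker_eq_bot, LinearMap.ker_eq_bot']
    intro f hf
    ext x
    exact hsep' _ fun i => LinearMap.congr_fun (congrFun hf i) x
  obtain ⟨F, hF⟩ := hJ.injective.out ι hι φ
  choose y hy using fun i => hJ.reflexive N (F ∘ₗ LinearMap.single R (fun _ => N →ₗ[R] J) i)
  have hφy : ∀ f : Module.End Λ N, φ f = ∑ i, q i (f (y i)) := fun f => by
    rw [← hF, linearMap_sum_single]
    exact Finset.sum_congr rfl fun i _ => hy i _
  -- the functionals of the form `x ↦ ∑ c i (a i • x)`
  let Φ : ∀ (X : Type u) [AddCommGroup X] [Module R X] [Module Λ X] [IsScalarTower R Λ X]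
      (c : Fin n → X →ₗ[R] J), (Fin n → Λ) →ₗ[R] (X →ₗ[R] J) := fun X _ _ _ _ c =>
    { toFun := fun a => ∑ i, c i ∘ₗ (Algebra.lsmul R R X (a i))
      map_add' := fun a b => by
        simp only [Pi.add_apply, map_add, LinearMap.comp_add, Finset.sum_add_distrib]
      map_smul' := fun r a => by
        simp only [Pi.smul_apply, map_smul, LinearMap.comp_smul, Finset.smul_sum,
          RingHom.id_apply] }
  have hΦ : ∀ (X : Type u) [AddCommGroup X] [Module R X] [Module Λ X] [IsScalarTower R Λ X]
      (c : Fin n → X →ₗ[R] J) (a : Fin n → Λ) (x : X), Φ X c a x = ∑ i, c i (a i • x) := by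
    intro X _ _ _ _ c a x
    simp [Φ]
  have hΦs : ∀ (X : Type u) [AddCommGroup X] [Module R X] [Module Λ X] [IsScalarTower R Λ X]
      (c : Fin n → X →ₗ[R] J) (i : Fin n), Φ X c (Pi.single i 1) = c i := by
    intro X _ _ _ _ c i
    ext x
    rw [hΦ, Finset.sum_eq_single i]
    · simp
    · intro j _ hj
      simp [hj]
    · simp
  have hsurj : Function.Surjective (Φ N q) := by
    rw [← LinearMap.range_eq_top, ← top_le_iff, ← hq, Submodule.span_le]
    rintro _ ⟨i, rfl⟩
    exact ⟨_, hΦs N q i⟩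
  obtain ⟨m, s, hs⟩ := Submodule.fg_iff_exists_fin_generating_family.1
    (IsNoetherian.noetherian (LinearMap.ker (Φ N q)))
  let T : Submodule Λ (N × (Fin m → Λ)) :=
    Submodule.span Λ (Set.range fun i => (y i, fun j => -(s j i)))
  have hfac : ∀ (X : Type u) [AddCommGroup X] [Module Λ X] (h : N →ₗ[Λ] X) (x : Fin m → X),
      (∀ i, h (y i) = ∑ j, s j i • x j) →
        ∃ h' : ((N × (Fin m → Λ)) ⧸ T) →ₗ[Λ] X, h' ∘ₗ T.mkQ ∘ₗ LinearMap.inl Λ _ _ = h := by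
    intro X _ _ h x hx
    let g : (N × (Fin m → Λ)) →ₗ[Λ] X := h.coprod (Fintype.linearCombination Λ x)
    refine ⟨T.liftQ g (Submodule.span_le.2 ?_), ?_⟩
    · rintro _ ⟨i, rfl⟩
      simp [g, hx, Fintype.linearCombination_apply]
    · ext z
      simp [g]
  refine ⟨_, inferInstance, inferInstance, inferInstance, T.mkQ ∘ₗ LinearMap.inl Λ _ _, ?_, ?_⟩
  · rintro ⟨r, hr⟩
    let x : Fin m → N := fun j => r (T.mkQ (0, Pi.single j 1))
    have hx : ∀ i, y i = ∑ j, s j i • x j := by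
      intro i
      have h₁ : r (T.mkQ (y i, 0)) = y i := LinearMap.congr_fun hr (y i)
      have h₂ : T.mkQ (y i, fun j => -(s j i)) = 0 :=
        (Submodule.Quotient.mk_eq_zero T).2 (Submodule.subset_span ⟨i, rfl⟩)
      have h₃ : ((y i, 0) : N × (Fin m → Λ)) = (y i, fun j => -(s j i)) +
          ∑ j, s j i • ((0, Pi.single j 1) : N × (Fin m → Λ)) := by
        refine Prod.ext ?_ ?_
        · simp [Prod.fst_sum]
        · funext k
          simp [Prod.snd_sum, Finset.sum_apply, Pi.single_apply]
      rw [h₃, map_add, h₂, zero_add, map_sum, map_sum] at h₁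
      rw [← h₁]
      exact Finset.sum_congr rfl fun j _ => by rw [map_smul, map_smul]
    refine hφ1 ?_
    rw [hφy]
    have h₀ : ∀ j, Φ N q (s j) = 0 := fun j => by
      have : s j ∈ LinearMap.ker (Φ N q) := hs ▸ Submodule.subset_span ⟨j, rfl⟩
      exact this
    calc ∑ i, q i ((1 : Module.End Λ N) (y i)) = ∑ i, ∑ j, q i (s j i • x j) := by
          refine Finset.sum_congr rfl fun i _ => ?_
          rw [← map_sum, ← hx i]
          rfl
      _ = ∑ j, Φ N q (s j) (x j) := by
          rw [Finset.sum_comm]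
          exact Finset.sum_congr rfl fun j _ => (hΦ N q _ _).symm
      _ = 0 := by simp [h₀]
  · intro X _ _ _ h hh
    obtain ⟨_, _⟩ := exists_restrictScalars R (Λ := Λ) X
    by_contra hne
    let σ : (Fin m → X) →ₗ[R] (Fin n → X) :=
      LinearMap.pi fun i => ∑ j, (Algebra.lsmul R R X (s j i)) ∘ₗ LinearMap.proj j
    have hσ : ∀ x i, σ x i = ∑ j, s j i • x j := fun x i => by simp [σ]
    have hy0 : (LinearMap.range σ).mkQ (fun i => h (y i)) ≠ 0 := by
      intro h0
      obtain ⟨x, hx⟩ := (Submodule.Quotient.mk_eq_zero _).1 h0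
      exact hne (hfac X h x fun i => by rw [← hσ, hx])
    obtain ⟨c', hc'⟩ := hJ.cogenerates _ _ hy0
    let c : (Fin n → X) →ₗ[R] J := c' ∘ₗ (LinearMap.range σ).mkQ
    have hcσ : ∀ x, c (σ x) = 0 := fun x => by
      have : (LinearMap.range σ).mkQ (σ x) = 0 := (Submodule.Quotient.mk_eq_zero _).2 ⟨x, rfl⟩
      rw [LinearMap.comp_apply, this, map_zero]
    let C : Fin n → X →ₗ[R] J := fun i => c ∘ₗ LinearMap.single R (fun _ => X) i
    have hker : LinearMap.ker (Φ N q) ≤ LinearMap.ker (Φ X C) := by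
      rw [← hs, Submodule.span_le]
      rintro _ ⟨j, rfl⟩
      refine LinearMap.ext fun x => ?_
      rw [hΦ, LinearMap.zero_apply, ← hcσ (Pi.single j x), linearMap_sum_single c]
      refine Finset.sum_congr rfl fun i _ => ?_
      rw [hσ, Finset.sum_eq_single j]
      · simp [C]
      · intro k _ hk
        simp [hk]
      · simp
    let θ : (N →ₗ[R] J) →ₗ[R] (X →ₗ[R] J) := (LinearMap.ker (Φ N q)).liftQ (Φ X C) hker ∘ₗ
      ((Φ N q).quotKerEquivOfSurjective hsurj).symm.toLinearMap
    have hθ : ∀ a, θ (Φ N q a) = Φ X C a := by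
      intro a
      have : ((Φ N q).quotKerEquivOfSurjective hsurj).symm (Φ N q a) =
          Submodule.Quotient.mk a := by
        rw [LinearEquiv.symm_apply_eq]
        rfl
      change (LinearMap.ker (Φ N q)).liftQ (Φ X C) hker
        (((Φ N q).quotKerEquivOfSurjective hsurj).symm (Φ N q a)) = _
      rw [this, Submodule.liftQ_apply]
    have hΦl : ∀ (X : Type u) [AddCommGroup X] [Module R X] [Module Λ X] [IsScalarTower R Λ X]
        (c : Fin n → X →ₗ[R] J) (a : Fin n → Λ) (l : Λ) (x : X),
        Φ X c a (l • x) = Φ X c (fun i => a i * l) x := by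
      intro X _ _ _ _ c a l x
      simp only [hΦ, mul_smul]
    choose u hu using fun x => hJ.reflexive N (θ.flip x)
    have hu' : ∀ x b, θ b x = b (u x) := hu
    let U : X →ₗ[Λ] N :=
      { toFun := u
        map_add' := fun x x' => hsep _ _ fun b => by
          rw [map_add, ← hu', ← hu', ← hu', map_add]
        map_smul' := fun l x => hsep _ _ fun b => by
          obtain ⟨a, rfl⟩ := hsurj b
          rw [← hu', hθ, RingHom.id_apply, hΦl, hΦl, ← hθ, hu'] }
    refine hh (isUnit_comp_splits (u := U) (hφ _ ?_))
    rw [hφy]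
    have h₁ : ∀ i x, q i (U x) = C i x := fun i x => by
      rw [← hΦs X C i, ← hθ, hΦs, hu']
      rfl
    simp only [LinearMap.comp_apply, h₁]
    have hc : c (fun i => h (y i)) ≠ 0 := hc'
    rw [linearMap_sum_single] at hc
    exact hc

end AlmostSplit

section Coinduced

variable {R : Type u} [CommRing R] {Λ : Type u} [Ring Λ] [Algebra R Λ]
  {J : Type u} [AddCommGroup J] [Module R J]

variable (R Λ J) in
/-- The coinduced module `Hom_R(Λ, J)`. -/
def CoindModule : Type u := Λ →ₗ[R] J

noncomputable instance : AddCommGroup (CoindModule R Λ J) :=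
  inferInstanceAs (AddCommGroup (Λ →ₗ[R] J))

noncomputable instance : Module R (CoindModule R Λ J) :=
  inferInstanceAs (Module R (Λ →ₗ[R] J))

noncomputable instance : Module Λ (CoindModule R Λ J) where
  smul μ ψ := (show Λ →ₗ[R] J from ψ) ∘ₗ LinearMap.mulRight R μ
  one_smul ψ := LinearMap.ext fun l => congrArg (show Λ →ₗ[R] J from ψ) (mul_one l)
  mul_smul a b ψ := LinearMap.ext fun l =>
    congrArg (show Λ →ₗ[R] J from ψ) (mul_assoc l a b).symm
  smul_zero _ := rfl
  smul_add _ _ _ := rfl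
  add_smul a b ψ := LinearMap.ext fun l =>
    (congrArg (show Λ →ₗ[R] J from ψ) (mul_add l a b)).trans (map_add _ _ _)
  zero_smul ψ := LinearMap.ext fun l =>
    (congrArg (show Λ →ₗ[R] J from ψ) (mul_zero l)).trans (map_zero _)

/-- The linear map underlying an element of the coinduced module. -/
noncomputable def CoindModule.toHom : CoindModule R Λ J →ₗ[R] (Λ →ₗ[R] J) := LinearMap.id

theorem CoindModule.smul_apply (μ : Λ) (ψ : CoindModule R Λ J) (l : Λ) :
    CoindModule.toHom (μ • ψ) l = CoindModule.toHom ψ (l * μ) := rfl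

theorem CoindModule.ext {ψ ψ' : CoindModule R Λ J}
    (h : ∀ l, CoindModule.toHom ψ l = CoindModule.toHom ψ' l) : ψ = ψ' := LinearMap.ext h

instance : IsScalarTower R Λ (CoindModule R Λ J) :=
  ⟨fun r μ ψ => CoindModule.ext fun l => by
    rw [CoindModule.smul_apply, map_smul, LinearMap.smul_apply, CoindModule.smul_apply,
      mul_smul_comm, map_smul]⟩

theorem CoindModule.finite [Module.Finite R Λ] (hJ : IsDualizingModule R J) :
    Module.Finite Λ (CoindModule R Λ J) := by
  have : Module.Finite R (CoindModule R Λ J) := hJ.finite_dual Λ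
  exact Module.Finite.of_restrictScalars_finite R Λ _

/-- Linear functionals on `X` correspond to homomorphisms to the coinduced module. -/
noncomputable def CoindModule.lift {X : Type u} [AddCommGroup X] [Module R X] [Module Λ X]
    [IsScalarTower R Λ X] (c : X →ₗ[R] J) : X →ₗ[Λ] CoindModule R Λ J where
  toFun x := c ∘ₗ (LinearMap.toSpanSingleton Λ X x).restrictScalars R
  map_add' x y := CoindModule.ext fun l =>
    (congrArg c (smul_add l x y)).trans (map_add c _ _)
  map_smul' μ x := CoindModule.ext fun l => congrArg c (smul_smul l μ x)

theorem CoindModule.lift_apply {X : Type u} [AddCommGroup X] [Module R X] [Module Λ X]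
    [IsScalarTower R Λ X] (c : X →ₗ[R] J) (x : X) (l : Λ) :
    CoindModule.toHom (CoindModule.lift (Λ := Λ) c x) l = c (l • x) := rfl

/-- There is a finitely generated module cogenerating all modules. -/
theorem exists_finite_cogenerator [Module.Finite R Λ] (hJ : IsDualizingModule R J) :
    ∃ (Q : Type u) (_ : AddCommGroup Q) (_ : Module Λ Q) (_ : Module.Finite Λ Q),
      ∀ (X : Type u) [AddCommGroup X] [Module Λ X] (x : X), x ≠ 0 →
        ∃ f : X →ₗ[Λ] Q, f x ≠ 0 := by
  refine ⟨CoindModule R Λ J, inferInstance, inferInstance, CoindModule.finite hJ, ?_⟩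
  intro X _ _ x hx
  obtain ⟨_, _⟩ := exists_restrictScalars R (Λ := Λ) X
  obtain ⟨c, hc⟩ := hJ.cogenerates X x hx
  refine ⟨CoindModule.lift c, fun h => hc ?_⟩
  have := CoindModule.lift_apply (Λ := Λ) c x 1
  rw [h, one_smul] at this
  exact this.symm

/-- Every indecomposable module `M` is the target of a right almost split map. -/
theorem exists_right_almost_split [IsArtinianRing R] [Module.Finite R Λ]
    (hJ : IsDualizingModule R J) (M : Type u) [AddCommGroup M] [Module Λ M]
    [Module.Finite Λ M] (hM : IsIndecomposableModule Λ M) :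
    ∃ (E : Type u) (_ : AddCommGroup E) (_ : Module Λ E) (_ : Module.Finite Λ E)
      (p : E →ₗ[Λ] M), (¬ ∃ t : M →ₗ[Λ] E, p ∘ₗ t = LinearMap.id) ∧
      ∀ (X : Type u) [AddCommGroup X] [Module Λ X] (h : X →ₗ[Λ] M),
        (¬ ∃ t : M →ₗ[Λ] X, h ∘ₗ t = LinearMap.id) → ∃ h' : X →ₗ[Λ] E, p ∘ₗ h' = h := by
  classical
  obtain ⟨_, _⟩ := exists_restrictScalars R (Λ := Λ) M
  have : Module.Finite R M := Module.Finite.trans Λ M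
  have : IsArtinian Λ M := isArtinian_of_tower R inferInstance
  have : IsNoetherian Λ M := isNoetherian_of_tower R inferInstance
  have : IsNoetherian Λ Λ := isNoetherian_of_tower R inferInstance
  have := CoindModule.finite (Λ := Λ) hJ
  have : IsNoetherian Λ (CoindModule R Λ J) := isNoetherian_of_isNoetherianRing_of_finite Λ _
  obtain ⟨φ, hφ1, hφ⟩ := hM.exists_functional hJ
  obtain ⟨n, q, hq⟩ := Module.Finite.exists_fin (R := Λ) (M := M)
  let π : (Fin n → Λ) →ₗ[Λ] M := Fintype.linearCombination Λ q
  have hπ : Function.Surjective π := by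
    rw [← LinearMap.range_eq_top, ← hq]
    exact Fintype.range_linearCombination Λ q
  obtain ⟨m, r, hr⟩ := Submodule.fg_iff_exists_fin_generating_family.1
    (IsNoetherian.noetherian (LinearMap.ker π))
  let ι : Module.End Λ M →ₗ[R] (Fin n → M) :=
    { toFun := fun f i => f (q i)
      map_add' := fun f g => rfl
      map_smul' := fun a f => rfl }
  have hι : Function.Injective ι := by
    intro f g h
    exact LinearMap.ext_on_range hq fun i => congrFun h i
  obtain ⟨F, hF⟩ := hJ.injective.out ι hι φ
  let Φ : Fin n → M →ₗ[R] J := fun i => F ∘ₗ LinearMap.single R (fun _ => M) i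
  have hΦ : ∀ f : Module.End Λ M, φ f = ∑ i, Φ i (f (q i)) := fun f => by
    rw [← hF, linearMap_sum_single]
    rfl
  let E : Submodule Λ (M × (Fin m → CoindModule R Λ J)) :=
    { carrier := {x | ∀ i l, Φ i (l • x.1) = ∑ j, CoindModule.toHom (x.2 j) (r j i * l)}
      zero_mem' := by
        intro i l
        simp
      add_mem' := by
        intro x y hx hy i l
        simp only [Prod.fst_add, Prod.snd_add, Pi.add_apply, smul_add, map_add,
          LinearMap.add_apply, Finset.sum_add_distrib]
        rw [hx, hy]
      smul_mem' := by
        intro μ x hx i l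
        simp only [Prod.smul_fst, Prod.smul_snd, Pi.smul_apply, CoindModule.smul_apply,
          smul_smul, mul_assoc]
        exact hx i (l * μ) }
  refine ⟨E, inferInstance, inferInstance, inferInstance, LinearMap.fst Λ _ _ ∘ₗ E.subtype, ?_, ?_⟩
  · rintro ⟨t, ht⟩
    have ht' : ∀ x, (t x : M × (Fin m → CoindModule R Λ J)).1 = x :=
      fun x => LinearMap.congr_fun ht x
    let Ψ : Fin m → M →ₗ[R] J := fun j => LinearMap.applyₗ (1 : Λ) ∘ₗ CoindModule.toHom ∘ₗ
      ((LinearMap.proj j ∘ₗ LinearMap.snd Λ _ _ ∘ₗ E.subtype ∘ₗ t :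
        M →ₗ[Λ] CoindModule R Λ J).restrictScalars R)
    have hΨ : ∀ j l x, CoindModule.toHom
        ((t x : M × (Fin m → CoindModule R Λ J)).2 j) l = Ψ j (l • x) := by
      intro j l x
      have : (t (l • x) : M × (Fin m → CoindModule R Λ J)).2 j =
          l • (t x : M × (Fin m → CoindModule R Λ J)).2 j := by
        rw [map_smul]
        rfl
      change _ = CoindModule.toHom ((t (l • x) : M × (Fin m → CoindModule R Λ J)).2 j) 1
      rw [this, CoindModule.smul_apply, one_mul]
    have hr0 : ∀ j, ∑ i, r j i • q i = 0 := fun j => by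
      have : r j ∈ LinearMap.ker π := hr ▸ Submodule.subset_span ⟨j, rfl⟩
      exact this
    refine hφ1 ?_
    rw [hΦ]
    calc ∑ i, Φ i ((1 : Module.End Λ M) (q i)) = ∑ i, ∑ j, Ψ j (r j i • q i) := by
          refine Finset.sum_congr rfl fun i _ => ?_
          have h₁ := (t (q i)).2 i 1
          rw [ht', one_smul] at h₁
          change Φ i (q i) = _
          rw [h₁]
          exact Finset.sum_congr rfl fun j _ => by rw [hΨ, mul_one]
      _ = ∑ j, Ψ j (∑ i, r j i • q i) := by
          rw [Finset.sum_comm]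
          exact Finset.sum_congr rfl fun j _ => (map_sum _ _ _).symm
      _ = 0 := by simp [hr0]
  · intro X _ _ h hh
    obtain ⟨_, _⟩ := exists_restrictScalars R (Λ := Λ) X
    let ρ : (Fin n → X) →ₗ[R] (Fin m → X) :=
      LinearMap.pi fun j => ∑ i, (Algebra.lsmul R R X (r j i)) ∘ₗ LinearMap.proj i
    have hρ : ∀ x j, ρ x j = ∑ i, r j i • x i := fun x j => by simp [ρ]
    let Θ : (Fin n → X) →ₗ[R] J := ∑ i, Φ i ∘ₗ h.restrictScalars R ∘ₗ LinearMap.proj i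
    have hΘ : ∀ x, Θ x = ∑ i, Φ i (h (x i)) := fun x => by simp [Θ]
    have hker : LinearMap.ker ρ ≤ LinearMap.ker Θ := by
      intro x hx
      have hle : LinearMap.ker π ≤ LinearMap.ker (Fintype.linearCombination Λ x) := by
        rw [← hr, Submodule.span_le]
        rintro _ ⟨j, rfl⟩
        exact (hρ x j).symm.trans (congrFun hx j)
      let f : M →ₗ[Λ] X := (LinearMap.ker π).liftQ _ hle ∘ₗ
        (π.quotKerEquivOfSurjective hπ).symm.toLinearMap
      have hf : ∀ i, f (q i) = x i := by
        intro i
        have h₁ : (π.quotKerEquivOfSurjective hπ).symm (q i) =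
            Submodule.Quotient.mk (Pi.single i 1) := by
          rw [LinearEquiv.symm_apply_eq]
          change _ = π _
          simp [π]
        change (LinearMap.ker π).liftQ _ hle ((π.quotKerEquivOfSurjective hπ).symm (q i)) = _
        rw [h₁, Submodule.liftQ_apply]
        simp
      have h0 : φ (h ∘ₗ f) = 0 := by
        by_contra h0
        exact hh (isUnit_comp_splits' (hφ _ h0))
      rw [hΦ] at h0
      change Θ x = 0
      rw [hΘ, ← h0]
      exact Finset.sum_congr rfl fun i _ => congrArg (fun z => Φ i (h z)) (hf i).symm
    obtain ⟨Ψ, hΨ⟩ := hJ.injective.out ((LinearMap.ker ρ).liftQ ρ le_rfl)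
      (LinearMap.ker_eq_bot.1 (Submodule.ker_liftQ_eq_bot _ _ _ le_rfl))
      ((LinearMap.ker ρ).liftQ Θ hker)
    have hΨ' : ∀ x, Ψ (ρ x) = Θ x := fun x => hΨ (Submodule.Quotient.mk x)
    let G : X →ₗ[Λ] M × (Fin m → CoindModule R Λ J) := h.prod (LinearMap.pi fun j =>
      CoindModule.lift (Ψ ∘ₗ LinearMap.single R (fun _ => X) j))
    refine ⟨G.codRestrict E ?_, ?_⟩
    · intro x i l
      have h₁ := hΨ' (Pi.single i (l • x))
      rw [hΘ, Finset.sum_eq_single i (fun k _ hk => by simp [hk]) (by simp), Pi.single_eq_same,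
        map_smul, linearMap_sum_single] at h₁
      refine h₁.symm.trans (Finset.sum_congr rfl fun j _ => ?_)
      rw [hρ, Finset.sum_eq_single i (fun k _ hk => by simp [hk]) (by simp), Pi.single_eq_same,
        smul_smul]
      rfl
    · ext x
      rfl

end Coinduced

section Radical

variable {Λ : Type*} [Ring Λ]

theorem isNilpotent_jacobson_end (R : Type*) [CommRing R] [IsArtinianRing R] [Algebra R Λ]
    (A : Type*) [AddCommGroup A] [Module R A] [Module Λ A] [IsScalarTower R Λ A]
    [Module.Finite R A] [Module.Finite Λ A] :
    IsNilpotent (Ideal.jacobson (⊥ : Ideal (Module.End Λ A))) := by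
  obtain ⟨n, q, hq⟩ := Module.Finite.exists_fin (R := Λ) (M := A)
  let ι : Module.End Λ A →ₗ[R] (Fin n → A) :=
    { toFun := fun f i => f (q i)
      map_add' := fun f g => rfl
      map_smul' := fun a f => rfl }
  have hι : Function.Injective ι := by
    intro f g h
    exact LinearMap.ext_on_range hq fun i => congrFun h i
  have := Module.Finite.of_injective ι hι
  have : IsArtinianRing (Module.End Λ A) := IsArtinianRing.of_finite R _
  exact IsArtinianRing.isNilpotent_jacobson_bot

variable {ι : Type*} [DecidableEq ι] {N : ι → Type*} [∀ i, AddCommGroup (N i)]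
  [∀ i, Module Λ (N i)]

theorem single_comp_proj_mem_jacobson [∀ i, IsArtinian Λ (N i)] [∀ i, IsNoetherian Λ (N i)]
    (hN : ∀ i, IsIndecomposableModule Λ (N i)) {i j : ι} {f : N i →ₗ[Λ] N j}
    (hf : ¬ Function.Bijective f) :
    (LinearMap.single Λ N j ∘ₗ f ∘ₗ LinearMap.proj i : Module.End Λ (∀ i, N i)) ∈
      Ideal.jacobson ⊥ := by
  rw [Ideal.mem_jacobson_iff]
  intro y
  let a : N i →ₗ[Λ] (∀ i, N i) := y ∘ₗ LinearMap.single Λ N j ∘ₗ f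
  let b : (∀ i, N i) →ₗ[Λ] N i := LinearMap.proj i
  have hba : ¬ IsUnit (-(b ∘ₗ a) : Module.End Λ (N i)) := by
    intro hu
    have hu' : IsUnit ((b ∘ₗ y ∘ₗ LinearMap.single Λ N j) ∘ₗ f : Module.End Λ (N i)) := by
      have := hu.neg
      rwa [neg_neg] at this
    have := (hN i).nontrivial
    exact hf ((hN j).bijective_of_comp_bijective f _
      ((Module.End.isUnit_iff _).1 hu')).1
  obtain ⟨c, hc⟩ := (hN i).isUnit_one_sub hba
  have hc' : (↑c⁻¹ : Module.End Λ (N i)) ∘ₗ (1 + b ∘ₗ a) = 1 := by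
    rw [← sub_neg_eq_add, ← hc]
    exact c.inv_mul
  refine ⟨1 - a ∘ₗ ↑c⁻¹ ∘ₗ b, ?_⟩
  rw [Ideal.mem_bot]
  have h₁ : y * (LinearMap.single Λ N j ∘ₗ f ∘ₗ LinearMap.proj i : Module.End Λ (∀ i, N i)) =
      a ∘ₗ b := rfl
  rw [mul_assoc, h₁]
  ext1 x
  have h₂ := LinearMap.congr_fun hc' (b x)
  simp only [LinearMap.comp_apply, LinearMap.add_apply, Module.End.one_apply, map_add] at h₂
  simp only [LinearMap.sub_apply, LinearMap.add_apply, Module.End.mul_apply,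
    LinearMap.comp_apply, Module.End.one_apply, LinearMap.zero_apply]
  have h₃ := congrArg a h₂
  rw [map_add] at h₃
  rw [eq_sub_of_add_eq h₃]
  abel

/-- A Nakayama-type lemma: if all maps `X → N i` are generated by members of `S` and by
maps factoring through a non-isomorphism `N j → N i`, then they all belong to `S`. -/
theorem mem_of_forall_mem_sup_radical [Fintype ι] [∀ i, IsArtinian Λ (N i)]
    [∀ i, IsNoetherian Λ (N i)] (hN : ∀ i, IsIndecomposableModule Λ (N i))
    (hnil : IsNilpotent (Ideal.jacobson (⊥ : Ideal (Module.End Λ (∀ i, N i)))))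
    {X : Type*} [AddCommGroup X] [Module Λ X] (S : ∀ i, AddSubgroup (X →ₗ[Λ] N i))
    (hS : ∀ i j (f : N i →ₗ[Λ] N j), ∀ h ∈ S i, f ∘ₗ h ∈ S j)
    (hred : ∀ i (g : X →ₗ[Λ] N i), g ∈ S i ⊔ AddSubgroup.closure
      {g | ∃ (j : ι) (f : N j →ₗ[Λ] N i) (h : X →ₗ[Λ] N j),
        ¬ Function.Bijective f ∧ g = f ∘ₗ h}) (i : ι) (g : X →ₗ[Λ] N i) : g ∈ S i := by
  set J := Ideal.jacobson (⊥ : Ideal (Module.End Λ (∀ i, N i)))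
  let S' : AddSubgroup (X →ₗ[Λ] (∀ i, N i)) :=
    { carrier := {g | ∀ i, LinearMap.proj i ∘ₗ g ∈ S i}
      zero_mem' := fun i => by
        rw [LinearMap.comp_zero]
        exact zero_mem _
      add_mem' := fun hg hh i => by
        rw [LinearMap.comp_add]
        exact add_mem (hg i) (hh i)
      neg_mem' := fun hg i => by
        rw [LinearMap.comp_neg]
        exact neg_mem (hg i) }
  have hS' : ∀ i (h : X →ₗ[Λ] N i), h ∈ S i → LinearMap.single Λ N i ∘ₗ h ∈ S' :=
    fun i h hh j => hS i j (LinearMap.proj j ∘ₗ LinearMap.single Λ N i) h hh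
  have hS'' : ∀ h ∈ S', ∀ r : Module.End Λ (∀ i, N i), r ∘ₗ h ∈ S' := by
    intro h hh r j
    have : LinearMap.proj j ∘ₗ r ∘ₗ h =
        ∑ i, (LinearMap.proj j ∘ₗ r ∘ₗ LinearMap.single Λ N i) ∘ₗ (LinearMap.proj i ∘ₗ h) := by
      ext1 x
      simp only [LinearMap.comp_apply, LinearMap.sum_apply, ← map_sum]
      congr 2
      exact (Finset.univ_sum_single (h x)).symm
    rw [this]
    exact sum_mem fun i _ => hS i j _ _ (hh i)
  have h₀ : (1 : Module.End Λ (∀ i, N i)) ∈ J ^ 0 := by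
    rw [Submodule.pow_zero, Ideal.one_eq_top]
    trivial
  let W : ℕ → AddSubgroup (X →ₗ[Λ] (∀ i, N i)) := fun k =>
    AddSubgroup.closure {g | ∃ r ∈ J ^ k, ∃ h : X →ₗ[Λ] (∀ i, N i), g = r ∘ₗ h}
  have h₁ : ∀ g : X →ₗ[Λ] (∀ i, N i), g ∈ S' ⊔ W 1 := by
    intro g
    have : g = ∑ i, LinearMap.single Λ N i ∘ₗ (LinearMap.proj i ∘ₗ g) := by
      ext1 x
      simp only [LinearMap.comp_apply, LinearMap.sum_apply]
      exact (Finset.univ_sum_single (g x)).symm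
    rw [this]
    refine sum_mem fun i _ => ?_
    let c : (X →ₗ[Λ] N i) →+ (X →ₗ[Λ] (∀ i, N i)) :=
      AddMonoidHom.mk' (fun h => LinearMap.single Λ N i ∘ₗ h) fun a b => LinearMap.comp_add _ _ _
    refine (sup_le ?_ ((AddSubgroup.closure_le _).2 ?_) : _ ≤ (S' ⊔ W 1).comap c)
      (hred i (LinearMap.proj i ∘ₗ g))
    · exact fun h hh => AddSubgroup.mem_sup_left (hS' i h hh)
    · rintro _ ⟨j, f, h, hf, rfl⟩
      refine AddSubgroup.mem_sup_right (AddSubgroup.subset_closure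
        ⟨_, (Submodule.pow_one J).ge (single_comp_proj_mem_jacobson hN hf),
          LinearMap.single Λ N j ∘ₗ h, ?_⟩)
      ext1 x
      simp [c]
  have h₂ : ∀ k (g : X →ₗ[Λ] (∀ i, N i)), g ∈ S' ⊔ W k := by
    intro k
    induction k with
    | zero =>
      exact fun g => AddSubgroup.mem_sup_right (AddSubgroup.subset_closure ⟨1, h₀, g, rfl⟩)
    | succ k ih =>
      intro g
      refine (sup_le le_sup_left ((AddSubgroup.closure_le _).2 ?_) : _ ≤ S' ⊔ W (k + 1)) (ih g)
      rintro _ ⟨r, hr, h, rfl⟩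
      let c : (X →ₗ[Λ] (∀ i, N i)) →+ (X →ₗ[Λ] (∀ i, N i)) :=
        AddMonoidHom.mk' (fun h => r ∘ₗ h) fun a b => LinearMap.comp_add _ _ _
      refine (sup_le ?_ ((AddSubgroup.closure_le _).2 ?_) : _ ≤ (S' ⊔ W (k + 1)).comap c) (h₁ h)
      · exact fun h hh => AddSubgroup.mem_sup_left (hS'' h hh r)
      · rintro _ ⟨s, hs, h, rfl⟩
        refine AddSubgroup.mem_sup_right (AddSubgroup.subset_closure ⟨r * s, ?_, h, rfl⟩)
        rw [Submodule.pow_succ]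
        exact Ideal.mul_mem_mul hr (by rwa [Submodule.pow_one] at hs)
  obtain ⟨k, hk⟩ := hnil
  have hW : W k ≤ S' := by
    refine (AddSubgroup.closure_le _).2 ?_
    rintro _ ⟨r, hr, h, rfl⟩
    rw [hk] at hr
    rw [show r = 0 from hr, LinearMap.zero_comp]
    exact zero_mem _
  have := (sup_le le_rfl hW) (h₂ k (LinearMap.single Λ N i ∘ₗ g)) i
  rwa [← LinearMap.comp_assoc, LinearMap.proj_comp_single_same, LinearMap.id_comp] at this

/-- If all maps `N i → M` are generated by maps factoring through a non-isomorphism `N i → N j`,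
then they all vanish. -/
theorem eq_zero_of_forall_mem_radical [Fintype ι] [∀ i, IsArtinian Λ (N i)]
    [∀ i, IsNoetherian Λ (N i)] (hN : ∀ i, IsIndecomposableModule Λ (N i))
    (hnil : IsNilpotent (Ideal.jacobson (⊥ : Ideal (Module.End Λ (∀ i, N i)))))
    {M : Type*} [AddCommGroup M] [Module Λ M]
    (hred : ∀ i (g : N i →ₗ[Λ] M), g ∈ AddSubgroup.closure
      {g | ∃ (j : ι) (f : N i →ₗ[Λ] N j) (h : N j →ₗ[Λ] M),
        ¬ Function.Bijective f ∧ g = h ∘ₗ f}) (i : ι) (g : N i →ₗ[Λ] M) : g = 0 := by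
  set J := Ideal.jacobson (⊥ : Ideal (Module.End Λ (∀ i, N i)))
  have h₀ : (1 : Module.End Λ (∀ i, N i)) ∈ J ^ 0 := by
    rw [Submodule.pow_zero, Ideal.one_eq_top]
    trivial
  let W : ℕ → AddSubgroup ((∀ i, N i) →ₗ[Λ] M) := fun k =>
    AddSubgroup.closure {g | ∃ r ∈ J ^ k, ∃ h : (∀ i, N i) →ₗ[Λ] M, g = h ∘ₗ r}
  have h₁ : ∀ g : (∀ i, N i) →ₗ[Λ] M, g ∈ W 1 := by
    intro g
    have : g = ∑ i, (g ∘ₗ LinearMap.single Λ N i) ∘ₗ LinearMap.proj i := by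
      refine LinearMap.ext fun x => ?_
      rw [LinearMap.sum_apply]
      simp only [LinearMap.comp_apply, ← map_sum]
      exact congrArg g (Finset.univ_sum_single x).symm
    rw [this]
    refine sum_mem fun i _ => ?_
    let c : (N i →ₗ[Λ] M) →+ ((∀ i, N i) →ₗ[Λ] M) :=
      AddMonoidHom.mk' (fun h => h ∘ₗ LinearMap.proj i) fun a b => LinearMap.add_comp _ _ _
    refine ((AddSubgroup.closure_le _).2 ?_ : _ ≤ (W 1).comap c)
      (hred i (g ∘ₗ LinearMap.single Λ N i))
    rintro _ ⟨j, f, h, hf, rfl⟩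
    refine AddSubgroup.subset_closure
      ⟨_, (Submodule.pow_one J).ge (single_comp_proj_mem_jacobson hN hf),
        h ∘ₗ LinearMap.proj j, ?_⟩
    refine LinearMap.ext fun x => ?_
    simp [c]
  have h₂ : ∀ k (g : (∀ i, N i) →ₗ[Λ] M), g ∈ W k := by
    intro k
    induction k with
    | zero =>
      exact fun g => AddSubgroup.subset_closure ⟨1, h₀, g, rfl⟩
    | succ k ih =>
      intro g
      refine ((AddSubgroup.closure_le _).2 ?_ : _ ≤ W (k + 1)) (h₁ g)
      rintro _ ⟨s, hs, h, rfl⟩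
      let c : ((∀ i, N i) →ₗ[Λ] M) →+ ((∀ i, N i) →ₗ[Λ] M) :=
        AddMonoidHom.mk' (fun h => h ∘ₗ s) fun a b => LinearMap.add_comp _ _ _
      refine ((AddSubgroup.closure_le _).2 ?_ : _ ≤ (W (k + 1)).comap c) (ih h)
      rintro _ ⟨r, hr, h, rfl⟩
      refine AddSubgroup.subset_closure ⟨r * s, ?_, h, rfl⟩
      rw [Submodule.pow_succ]
      exact Ideal.mul_mem_mul hr (by rwa [Submodule.pow_one] at hs)
  obtain ⟨k, hk⟩ := hnil
  have hW : W k ≤ ⊥ := by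
    refine (AddSubgroup.closure_le _).2 ?_
    rintro _ ⟨r, hr, h, rfl⟩
    rw [hk] at hr
    rw [show r = 0 from hr, LinearMap.comp_zero]
    exact zero_mem _
  have h₃ : g ∘ₗ LinearMap.proj i = 0 := hW (h₂ k _)
  rw [← LinearMap.comp_id g, ← LinearMap.proj_comp_single_same Λ N i, ← LinearMap.comp_assoc, h₃,
    LinearMap.zero_comp]

end Radical

section FactorThrough

variable {Λ : Type*} [Ring Λ] {ι : Type*} (N : ι → Type*) [∀ i, AddCommGroup (N i)]
  [∀ i, Module Λ (N i)]

/-- The maps `X → M` which are finite sums of maps factoring through members of the family `N`. -/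
def factorThrough (X M : Type*) [AddCommGroup X] [Module Λ X] [AddCommGroup M] [Module Λ M] :
    AddSubgroup (X →ₗ[Λ] M) :=
  AddSubgroup.closure {g | ∃ (j : ι) (f : X →ₗ[Λ] N j) (h : N j →ₗ[Λ] M), g = h ∘ₗ f}

variable {N} {X M X' M' : Type*} [AddCommGroup X] [Module Λ X] [AddCommGroup M] [Module Λ M]
  [AddCommGroup X'] [Module Λ X'] [AddCommGroup M'] [Module Λ M']

theorem comp_mem_factorThrough {j : ι} (f : X →ₗ[Λ] N j) (h : N j →ₗ[Λ] M) :
    h ∘ₗ f ∈ factorThrough N X M :=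
  AddSubgroup.subset_closure ⟨j, f, h, rfl⟩

theorem factorThrough_precomp {g : X →ₗ[Λ] M} (hg : g ∈ factorThrough N X M)
    (f : X' →ₗ[Λ] X) : g ∘ₗ f ∈ factorThrough N X' M := by
  let c : (X →ₗ[Λ] M) →+ (X' →ₗ[Λ] M) :=
    AddMonoidHom.mk' (fun h => h ∘ₗ f) fun a b => LinearMap.add_comp _ _ _
  refine ((AddSubgroup.closure_le _).2 ?_ : _ ≤ (factorThrough N X' M).comap c) hg
  rintro _ ⟨j, a, b, rfl⟩
  exact comp_mem_factorThrough (a ∘ₗ f) b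

theorem factorThrough_postcomp {g : X →ₗ[Λ] M} (hg : g ∈ factorThrough N X M)
    (f : M →ₗ[Λ] M') : f ∘ₗ g ∈ factorThrough N X M' := by
  let c : (X →ₗ[Λ] M) →+ (X →ₗ[Λ] M') :=
    AddMonoidHom.mk' (fun h => f ∘ₗ h) fun a b => LinearMap.comp_add _ _ _
  refine ((AddSubgroup.closure_le _).2 ?_ : _ ≤ (factorThrough N X M').comap c) hg
  rintro _ ⟨j, a, b, rfl⟩
  exact comp_mem_factorThrough a (f ∘ₗ b)

theorem mem_factorThrough_of_equiv_left {j : ι} (e : X ≃ₗ[Λ] N j) (g : X →ₗ[Λ] M) :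
    g ∈ factorThrough N X M := by
  have h : g = (g ∘ₗ e.symm.toLinearMap) ∘ₗ e.toLinearMap := by
    ext x
    simp
  rw [h]
  exact comp_mem_factorThrough _ _

end FactorThrough

section FactorThroughRange

variable {Λ : Type*} [Ring Λ] {ι : Type*} {N : ι → Type*} [∀ i, AddCommGroup (N i)]
  [∀ i, Module Λ (N i)] {X : Type*} {M : Type u} [AddCommGroup X] [Module Λ X] [AddCommGroup M]
  [Module Λ M]

theorem id_mem_factorThrough [IsArtinian Λ M] [IsNoetherian Λ M]
    (h : ∀ U : Submodule Λ M, IsIndecomposableModule Λ U → ∃ i, Nonempty (U ≃ₗ[Λ] N i)) :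
    (LinearMap.id : M →ₗ[Λ] M) ∈ factorThrough N M M := by
  obtain ⟨κ, _, p, hp, hsum⟩ := exists_sum_indecomposable (Λ := Λ) M
  rw [← hsum]
  refine sum_mem fun k _ => ?_
  obtain ⟨i, ⟨e⟩⟩ := h _ (hp k)
  exact factorThrough_precomp (g := (LinearMap.range (p k)).subtype)
    (mem_factorThrough_of_equiv_left e _) (p k).rangeRestrict

theorem mem_factorThrough_of_range [IsArtinian Λ M] [IsNoetherian Λ M] (g : X →ₗ[Λ] M)
    (h : ∀ U : Submodule Λ M, U ≤ LinearMap.range g → IsIndecomposableModule Λ U →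
      ∃ i, Nonempty (U ≃ₗ[Λ] N i)) : g ∈ factorThrough N X M := by
  have hid : (LinearMap.id : LinearMap.range g →ₗ[Λ] LinearMap.range g) ∈
      factorThrough N (LinearMap.range g) (LinearMap.range g) := by
    refine id_mem_factorThrough fun U hU => ?_
    have e := Submodule.equivMapOfInjective (LinearMap.range g).subtype
      (LinearMap.range g).injective_subtype U
    obtain ⟨i, ⟨e'⟩⟩ := h _ (Submodule.map_subtype_le _ U) (hU.congr e)
    exact ⟨i, ⟨e.trans e'⟩⟩
  exact factorThrough_precomp (factorThrough_postcomp hid (LinearMap.range g).subtype)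
    g.rangeRestrict

end FactorThroughRange

/-- There are, up to isomorphism, only finitely many indecomposable finitely generated modules
with Gabriel–Roiter measure in `L`. -/
def IsFiniteTypeOn (Λ : Type u) [Ring Λ] (L : Set (Set ℕ)) : Prop :=
  ∃ (n : ℕ) (N : Fin n → BundledMod Λ), (∀ i, Module.Finite Λ (N i).carrier) ∧
    (∀ i, IsIndecomposableModule Λ (N i).carrier) ∧ (∀ i, grMeasure Λ (N i).carrier ∈ L) ∧
    ∀ (M : Type u) [AddCommGroup M] [Module Λ M], Module.Finite Λ M →
      IsIndecomposableModule Λ M → grMeasure Λ M ∈ L → ∃ i, Nonempty (M ≃ₗ[Λ] (N i).carrier)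

theorem isFiniteTypeOn_of_finite {Λ : Type u} [Ring Λ] {L : Set (Set ℕ)} {κ : Type*} [Finite κ]
    (Y : κ → BundledMod Λ)
    (h : ∀ (M : Type u) [AddCommGroup M] [Module Λ M], Module.Finite Λ M →
      IsIndecomposableModule Λ M → grMeasure Λ M ∈ L →
        ∃ k, Nonempty (M ≃ₗ[Λ] (Y k).carrier)) [IsArtinianRing Λ] : IsFiniteTypeOn Λ L := by
  let T := {k // Module.Finite Λ (Y k).carrier ∧ IsIndecomposableModule Λ (Y k).carrier ∧
    grMeasure Λ (Y k).carrier ∈ L}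
  let e := Finite.equivFin T
  refine ⟨_, fun i => Y (e.symm i).1, fun i => (e.symm i).2.1, fun i => (e.symm i).2.2.1,
    fun i => (e.symm i).2.2.2, fun M _ _ hM hM' hL => ?_⟩
  obtain ⟨k, ⟨f⟩⟩ := h M hM hM' hL
  have hk : Module.Finite Λ (Y k).carrier ∧ IsIndecomposableModule Λ (Y k).carrier ∧
      grMeasure Λ (Y k).carrier ∈ L :=
    ⟨Module.Finite.equiv f, hM'.congr f, grMeasure_congr f hM' ▸ hL⟩
  refine ⟨e ⟨k, hk⟩, ⟨?_⟩⟩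
  beta_reduce
  rw [e.symm_apply_apply]
  exact f

section TakeOff

variable {Λ : Type u} [Ring Λ]

theorem isNilpotent_jacobson_end_pi (R : Type u) [CommRing R] [Algebra R Λ] [IsArtinianRing R]
    [Module.Finite R Λ] {ι : Type} [Finite ι] (N : ι → BundledMod Λ)
    (hfin : ∀ i, Module.Finite Λ (N i).carrier) :
    IsNilpotent (Ideal.jacobson (⊥ : Ideal (Module.End Λ (∀ i, (N i).carrier)))) := by
  obtain ⟨_, _⟩ := exists_restrictScalars R (Λ := Λ) (∀ i, (N i).carrier)
  have : Module.Finite R (∀ i, (N i).carrier) := Module.Finite.trans Λ _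
  exact isNilpotent_jacobson_end R _

variable [IsArtinianRing Λ]

theorem exists_test_module (R : Type u) [CommRing R] [Algebra R Λ] [IsArtinianRing R]
    [Module.Finite R Λ] {n : ℕ} (N : Fin n → BundledMod Λ)
    (hfin : ∀ i, Module.Finite Λ (N i).carrier)
    (hN : ∀ i, IsIndecomposableModule Λ (N i).carrier) :
    ∃ (E : Type u) (_ : AddCommGroup E) (_ : Module Λ E) (_ : Module.Finite Λ E),
      ∀ (M : Type u) [AddCommGroup M] [Module Λ M] [Module.Finite Λ M],
        IsIndecomposableModule Λ M → (∀ i, IsEmpty (M ≃ₗ[Λ] (N i).carrier)) →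
        ∃ g : E →ₗ[Λ] M, g ∉ factorThrough (fun i => (N i).carrier) E M := by
  obtain ⟨J, _, _, hJ⟩ := exists_isDualizingModule R
  choose E _ _ _ s hs hsplit using fun i => exists_left_almost_split hJ (N i).carrier (hN i)
  refine ⟨Λ × ∀ i, E i, inferInstance, inferInstance, inferInstance, ?_⟩
  intro M _ _ _ hM hiso
  by_contra! hall
  have hE : ∀ i (g : E i →ₗ[Λ] M), g ∈ factorThrough (fun i => (N i).carrier) (E i) M := by
    intro i g
    have := factorThrough_precomp (hall (g ∘ₗ LinearMap.proj i ∘ₗ LinearMap.snd Λ Λ (∀ i, E i)))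
      (LinearMap.inr Λ Λ (∀ i, E i) ∘ₗ LinearMap.single Λ E i)
    convert this using 1
    refine LinearMap.ext fun x => ?_
    simp
  have hΛ : ∀ g : Λ →ₗ[Λ] M, g ∈ factorThrough (fun i => (N i).carrier) Λ M := by
    intro g
    have := factorThrough_precomp (hall (g ∘ₗ LinearMap.fst Λ Λ (∀ i, E i)))
      (LinearMap.inl Λ Λ (∀ i, E i))
    convert this using 1
    refine LinearMap.ext fun x => ?_
    simp
  have hzero : ∀ i (g : (N i).carrier →ₗ[Λ] M), g = 0 := by
    refine eq_zero_of_forall_mem_radical hN (isNilpotent_jacobson_end_pi R N hfin) ?_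
    intro i g
    have hg : ¬ ∃ r : M →ₗ[Λ] (N i).carrier, r ∘ₗ g = LinearMap.id := by
      rintro ⟨r, hr⟩
      have := (hN i).nontrivial
      have hb := hM.bijective_of_comp_bijective g r (by rw [hr]; exact Function.bijective_id)
      exact (hiso i).false (LinearEquiv.ofBijective g hb.1).symm
    obtain ⟨h', rfl⟩ := hsplit i M g hg
    let c : (E i →ₗ[Λ] M) →+ ((N i).carrier →ₗ[Λ] M) :=
      AddMonoidHom.mk' (fun h => h ∘ₗ s i) fun a b => LinearMap.add_comp _ _ _
    refine ((AddSubgroup.closure_le _).2 ?_ : _ ≤ (AddSubgroup.closure _).comap c) (hE i h')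
    rintro _ ⟨j, a, b, rfl⟩
    refine AddSubgroup.subset_closure ⟨j, a ∘ₗ s i, b, fun hb => hs i ?_, rfl⟩
    let e := LinearEquiv.ofBijective _ hb
    refine ⟨e.symm.toLinearMap ∘ₗ a, LinearMap.ext fun x => ?_⟩
    exact e.symm_apply_apply x
  have hbot : factorThrough (Λ := Λ) (fun i => (N i).carrier) Λ M ≤ ⊥ := by
    refine (AddSubgroup.closure_le _).2 ?_
    rintro _ ⟨j, a, b, rfl⟩
    rw [hzero j b, LinearMap.zero_comp]
    exact zero_mem _
  have := hM.nontrivial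
  obtain ⟨x, hx⟩ := exists_ne (0 : M)
  refine hx ?_
  have h0 : LinearMap.toSpanSingleton Λ M x = 0 := hbot (hΛ _)
  simpa using LinearMap.congr_fun h0 1

theorem exists_grle_min_not_mem (R : Type u) [CommRing R] [Algebra R Λ] [IsArtinianRing R]
    [Module.Finite R Λ] {L : Set (Set ℕ)} (hL : IsFiniteTypeOn Λ L)
    (hne : ∃ I, IsGRMeasureOf Λ I ∧ I ∉ L) :
    ∃ I, IsGRMeasureOf Λ I ∧ I ∉ L ∧ ∀ J, IsGRMeasureOf Λ J → J ∉ L → GRle I J := by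
  obtain ⟨n, N, hfin, hN, hNL, hrep⟩ := hL
  obtain ⟨E, _, _, _, hE⟩ := exists_test_module R N hfin hN
  have hbound : ∀ (M : Type u) [AddCommGroup M] [Module Λ M] [Module.Finite Λ M],
      IsIndecomposableModule Λ M → grMeasure Λ M ∉ L →
      (∀ U : Submodule Λ M, U ≠ ⊤ → IsIndecomposableModule Λ U → grMeasure Λ U ∈ L) →
      mlen Λ M ≤ mlen Λ E := by
    intro M _ _ _ hM hML hsub
    obtain ⟨g, hg⟩ := hE M hM fun i => ⟨fun e => hML (grMeasure_congr e hM ▸ hNL i)⟩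
    refine mlen_le_of_surjective g (LinearMap.range_eq_top.1 (not_not.1 fun htop => hg ?_))
    exact mem_factorThrough_of_range g fun U hU hU' =>
      hrep U inferInstance hU' (hsub U (fun h => htop (top_le_iff.1 (h ▸ hU))) hU')
  have hsmall : ∀ J, IsGRMeasureOf Λ J → J ∉ L → ∃ I, IsGRMeasureOf Λ I ∧ I ∉ L ∧
      I ⊆ Set.Iic (mlen Λ E) ∧ GRle I J := by
    rintro _ ⟨M, _, _, _, hM, rfl⟩ hML
    obtain ⟨U, ⟨hU, hUL⟩, hmin⟩ := (wellFounded_lt (α := Submodule Λ M)).has_min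
      {U | IsIndecomposableModule Λ U ∧ grMeasure Λ U ∉ L}
      ⟨⊤, hM.congr Submodule.topEquiv.symm, by
        rwa [← grMeasure_congr Submodule.topEquiv.symm hM]⟩
    refine ⟨_, ⟨U, _, _, inferInstance, hU, rfl⟩, hUL, ?_,
      grMeasure_le_of_injective U.subtype U.injective_subtype hU hM⟩
    refine (grChainSets_subset_Iic (grMeasure_spec hU).1).trans
      (Set.Iic_subset_Iic.2 (hbound U hU hUL fun V hV hV' => ?_))
    by_contra hVL
    have e := Submodule.equivMapOfInjective U.subtype U.injective_subtype V
    refine hmin (V.map U.subtype) ⟨hV'.congr e, by rwa [← grMeasure_congr e hV']⟩ ?_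
    refine lt_of_le_of_ne (Submodule.map_subtype_le _ _) fun h => hV ?_
    exact Submodule.map_injective_of_injective U.injective_subtype
      (h.trans (Submodule.map_subtype_top U).symm)
  obtain ⟨I₀, hI₀, hI₀L⟩ := hne
  obtain ⟨I₁, h₁, h₂, h₃, -⟩ := hsmall I₀ hI₀ hI₀L
  obtain ⟨I, ⟨hI, hIL, -⟩, hmin⟩ := exists_grle_min
    (𝒮 := {I | IsGRMeasureOf Λ I ∧ I ∉ L ∧ I ⊆ Set.Iic (mlen Λ E)})
    ((Set.finite_Iic (mlen Λ E)).finite_subsets.subset fun _ h => h.2.2) ⟨I₁, h₁, h₂, h₃⟩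
  refine ⟨I, hI, hIL, fun J hJ hJL => ?_⟩
  obtain ⟨I', h₁, h₂, h₃, h₄⟩ := hsmall J hJ hJL
  exact (hmin I' ⟨h₁, h₂, h₃⟩).trans h₄

theorem IsFiniteTypeOn.insert_min (R : Type u) [CommRing R] [Algebra R Λ] [IsArtinianRing R]
    [Module.Finite R Λ] {L : Set (Set ℕ)} (hL : IsFiniteTypeOn Λ L)
    {I : Set ℕ} (hIL : I ∉ L) (hmin : ∀ J, IsGRMeasureOf Λ J → J ∉ L → GRle I J) :
    IsFiniteTypeOn Λ (insert I L) := by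
  obtain ⟨n, N, hfin, hN, hNL, hrep⟩ := hL
  obtain ⟨E, _, _, _, hE⟩ := exists_test_module R N hfin hN
  have hlt : ∀ J, IsGRMeasureOf Λ J → GRlt J I → J ∈ L := fun J hJ h =>
    not_not.1 fun hJL => (hmin J hJ hJL).not_grlt h
  let 𝒦 : Set (Submodule Λ E) := {K | ∃ (Y : Type u) (_ : AddCommGroup Y) (_ : Module Λ Y)
    (_ : Module.Finite Λ Y) (g : E →ₗ[Λ] Y), IsIndecomposableModule Λ Y ∧
      GRle (grMeasure Λ Y) I ∧ K = LinearMap.ker g}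
  let E' := E ⧸ sInf 𝒦
  have hE' : ∀ U : Submodule Λ E', IsIndecomposableModule Λ U → GRle (grMeasure Λ U) I := by
    intro U hU
    choose Y _ _ _ g hY hYI hg using fun K : 𝒦 => K.2
    let g' : ∀ K : 𝒦, U →ₗ[Λ] Y K := fun K =>
      (sInf 𝒦).liftQ (g K) ((sInf_le K.2).trans (hg K).le) ∘ₗ U.subtype
    have hinj : ∀ x, (∀ K, g' K x = 0) → x = 0 := by
      intro ⟨x, hx⟩ h
      obtain ⟨y, rfl⟩ := Submodule.mkQ_surjective _ x
      refine Subtype.ext ((Submodule.Quotient.mk_eq_zero _).2 ?_)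
      rw [Submodule.mem_sInf]
      intro K hK
      exact (hg ⟨K, hK⟩).ge (h ⟨K, hK⟩)
    rcases gabriel_main_property (Λ := Λ) _ U rfl hU 𝒦 Y g' hY hinj with ⟨K, hK⟩ | ⟨K, hK⟩
    · rw [grMeasure_congr (LinearEquiv.ofBijective _ hK) hU]
      exact hYI K
    · exact Or.inr (hK.trans_le (hYI K))
  obtain ⟨κ, _, p, hp, hsum⟩ := exists_sum_indecomposable (Λ := Λ) E'
  let Z : Fin n ⊕ κ → BundledMod Λ := Sum.elim N fun k => ⟨LinearMap.range (p k)⟩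
  refine isFiniteTypeOn_of_finite Z fun M _ _ _ hM hMI => ?_
  by_contra! hne
  have hML : grMeasure Λ M ∉ L := fun h => by
    obtain ⟨i, hi⟩ := hrep M inferInstance hM h
    exact (not_isEmpty_iff.2 hi) (hne (Sum.inl i))
  obtain rfl := hMI.resolve_right hML
  obtain ⟨g, hg⟩ := hE M hM fun i => hne (Sum.inl i)
  have hker : sInf 𝒦 ≤ LinearMap.ker g :=
    sInf_le ⟨M, _, _, inferInstance, g, hM, Or.inl rfl, rfl⟩
  let g' : E' →ₗ[Λ] M := (sInf 𝒦).liftQ g hker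
  have hg' : g' ∈ factorThrough (fun i => (N i).carrier) E' M := by
    have hsum' : g' = ∑ k, g' ∘ₗ p k := by
      refine LinearMap.ext fun x => ?_
      rw [LinearMap.sum_apply]
      simp only [LinearMap.comp_apply, ← map_sum, ← LinearMap.sum_apply, hsum, LinearMap.id_apply]
    rw [hsum']
    refine sum_mem fun k _ => ?_
    refine factorThrough_precomp (g := g' ∘ₗ (LinearMap.range (p k)).subtype) ?_
      (p k).rangeRestrict
    by_cases hk : grMeasure Λ (LinearMap.range (p k)) ∈ L
    · obtain ⟨i, ⟨e⟩⟩ := hrep _ inferInstance (hp k) hk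
      exact mem_factorThrough_of_equiv_left (N := fun i => (N i).carrier) e _
    have heq : grMeasure Λ (LinearMap.range (p k)) = grMeasure Λ M :=
      (hE' _ (hp k)).antisymm (hmin _ ⟨_, _, _, inferInstance, hp k, rfl⟩ hk)
    have hlen := mlen_eq_of_grMeasure_eq (hp k) hM heq
    refine mem_factorThrough_of_range _ fun U hU hU' => hrep U inferInstance hU' ?_
    refine hlt _ ⟨_, _, _, inferInstance, hU', rfl⟩ (grMeasure_submodule_lt hM ?_ hU')
    rintro rfl
    have hb := bijective_of_surjective_of_mlen_le _ (LinearMap.range_eq_top.1 (top_le_iff.1 hU))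
      hlen.le
    exact (hne (Sum.inr k)).false (LinearEquiv.ofBijective _ hb).symm
  exact hg (factorThrough_precomp hg' (sInf 𝒦).mkQ)

end TakeOff

section Landing

variable {Λ : Type u} [Ring Λ] [IsArtinianRing Λ]

theorem exists_cogenerating_family (R : Type u) [CommRing R] [Algebra R Λ] [IsArtinianRing R]
    [Module.Finite R Λ] {L : Set (Set ℕ)} (hL : IsFiniteTypeOn Λ L) :
    ∃ (κ : Type) (_ : Finite κ) (C : κ → BundledMod Λ), (∀ k, Module.Finite Λ (C k).carrier) ∧
      (∀ k, IsIndecomposableModule Λ (C k).carrier) ∧ (∀ k, grMeasure Λ (C k).carrier ∉ L) ∧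
      ∀ (M : Type u) [AddCommGroup M] [Module Λ M] [Module.Finite Λ M],
        IsIndecomposableModule Λ M → grMeasure Λ M ∉ L → ∀ x : M,
          (∀ k (f : M →ₗ[Λ] (C k).carrier), f x = 0) → x = 0 := by
  obtain ⟨n, A, hfin, hA, hAL, hrep⟩ := hL
  obtain ⟨J, _, _, hJ⟩ := exists_isDualizingModule R
  obtain ⟨Q, _, _, _, hQ⟩ := exists_finite_cogenerator (Λ := Λ) hJ
  choose E _ _ _ p hp hsplit using fun i => exists_right_almost_split hJ (A i).carrier (hA i)
  obtain ⟨κ, _, q, hq, hsum⟩ := exists_sum_indecomposable (Λ := Λ) (Q × ∀ i, E i)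
  let C : {k // grMeasure Λ (LinearMap.range (q k)) ∉ L} → BundledMod Λ :=
    fun k => ⟨LinearMap.range (q k.1)⟩
  refine ⟨_, inferInstance, C, fun k => inferInstanceAs (Module.Finite Λ (LinearMap.range (q k.1))),
    fun k => hq k.1, fun k => k.2, ?_⟩
  intro M _ _ _ hM hML x hx
  have hdecomp : ∀ {Z : Type u} [AddCommGroup Z] [Module Λ Z]
      (a : (Q × ∀ i, E i) →ₗ[Λ] Z) (b : M →ₗ[Λ] (Q × ∀ i, E i)),
      a ∘ₗ b = ∑ k, (a ∘ₗ (LinearMap.range (q k)).subtype) ∘ₗ ((q k).rangeRestrict ∘ₗ b) := by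
    intro Z _ _ a b
    refine LinearMap.ext fun x => ?_
    rw [LinearMap.sum_apply]
    have h := LinearMap.congr_fun hsum (b x)
    rw [LinearMap.sum_apply] at h
    conv_lhs => rw [LinearMap.comp_apply, ← LinearMap.id_apply (R := Λ) (b x), ← h, map_sum]
    rfl
  have hmem : ∀ {Z : Type u} [AddCommGroup Z] [Module Λ Z] (k : κ),
      grMeasure Λ (LinearMap.range (q k)) ∉ L → ∀ (a : LinearMap.range (q k) →ₗ[Λ] Z)
        (b : M →ₗ[Λ] LinearMap.range (q k)),
        a ∘ₗ b ∈ factorThrough (fun k => (C k).carrier) M Z := fun k hk a b =>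
    comp_mem_factorThrough (N := fun k => (C k).carrier) (j := ⟨k, hk⟩) b a
  have hAM : ∀ i (g : M →ₗ[Λ] (A i).carrier),
      g ∈ factorThrough (fun k => (C k).carrier) M (A i).carrier := by
    refine mem_of_forall_mem_sup_radical hA (isNilpotent_jacobson_end_pi R A hfin)
      (fun i => factorThrough (fun k => (C k).carrier) M (A i).carrier)
      (fun i j f h hh => factorThrough_postcomp hh f) ?_
    intro i g
    have hg : ¬ ∃ t : (A i).carrier →ₗ[Λ] M, g ∘ₗ t = LinearMap.id := by
      rintro ⟨t, ht⟩
      have := (hA i).nontrivial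
      have hb := hM.bijective_of_comp_bijective t g (by rw [ht]; exact Function.bijective_id)
      exact hML (grMeasure_congr (LinearEquiv.ofBijective g hb.2) hM ▸ hAL i)
    obtain ⟨h', rfl⟩ := hsplit i M g hg
    let a : (Q × ∀ i, E i) →ₗ[Λ] (A i).carrier :=
      p i ∘ₗ LinearMap.proj i ∘ₗ LinearMap.snd Λ Q (∀ i, E i)
    let b : M →ₗ[Λ] (Q × ∀ i, E i) := LinearMap.inr Λ Q (∀ i, E i) ∘ₗ LinearMap.single Λ E i ∘ₗ h'
    have hab : p i ∘ₗ h' = a ∘ₗ b := by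
      refine LinearMap.ext fun x => ?_
      simp [a, b]
    rw [hab, hdecomp]
    refine sum_mem fun k _ => ?_
    by_cases hk : grMeasure Λ (LinearMap.range (q k)) ∈ L
    · obtain ⟨j, ⟨e⟩⟩ := hrep _ inferInstance (hq k) hk
      refine AddSubgroup.mem_sup_right (AddSubgroup.subset_closure
        ⟨j, (a ∘ₗ (LinearMap.range (q k)).subtype) ∘ₗ e.symm.toLinearMap,
          e.toLinearMap ∘ₗ ((q k).rangeRestrict ∘ₗ b), fun hb => hp i ?_, ?_⟩)
      · let e' := LinearEquiv.ofBijective _ hb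
        refine ⟨LinearMap.proj i ∘ₗ LinearMap.snd Λ Q (∀ i, E i) ∘ₗ
          (LinearMap.range (q k)).subtype ∘ₗ e.symm.toLinearMap ∘ₗ e'.symm.toLinearMap,
          LinearMap.ext fun x => ?_⟩
        exact e'.apply_symm_apply x
      · refine LinearMap.ext fun x => ?_
        simp
    · exact AddSubgroup.mem_sup_left (hmem k hk _ _)
  have hQM : ∀ f : M →ₗ[Λ] Q, f ∈ factorThrough (fun k => (C k).carrier) M Q := by
    intro f
    have hab : f = LinearMap.fst Λ Q (∀ i, E i) ∘ₗ LinearMap.inl Λ Q (∀ i, E i) ∘ₗ f := by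
      refine LinearMap.ext fun x => ?_
      simp
    rw [hab, hdecomp]
    refine sum_mem fun k _ => ?_
    by_cases hk : grMeasure Λ (LinearMap.range (q k)) ∈ L
    · obtain ⟨j, ⟨e⟩⟩ := hrep _ inferInstance (hq k) hk
      refine factorThrough_postcomp ?_ _
      have := factorThrough_postcomp (hAM j (e.toLinearMap ∘ₗ ((q k).rangeRestrict ∘ₗ
        (LinearMap.inl Λ Q (∀ i, E i) ∘ₗ f)))) e.symm.toLinearMap
      convert this using 1
      refine LinearMap.ext fun x => ?_
      simp
    · exact hmem k hk _ _
  by_contra hx0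
  obtain ⟨f, hf⟩ := hQ M x hx0
  refine hf ?_
  let ev : (M →ₗ[Λ] Q) →+ Q := AddMonoidHom.mk' (fun h => h x) fun a b => rfl
  refine ((AddSubgroup.closure_le _).2 ?_ : _ ≤ ev.ker) (hQM f)
  rintro _ ⟨k, a, b, rfl⟩
  change b (a x) = 0
  rw [hx k a, map_zero]

theorem exists_grle_max_not_mem (R : Type u) [CommRing R] [Algebra R Λ] [IsArtinianRing R]
    [Module.Finite R Λ] {L : Set (Set ℕ)} (hL : IsFiniteTypeOn Λ L)
    (hne : ∃ I, IsGRMeasureOf Λ I ∧ I ∉ L) :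
    ∃ I, IsGRMeasureOf Λ I ∧ I ∉ L ∧ (∀ J, IsGRMeasureOf Λ J → J ∉ L → GRle J I) ∧
      IsFiniteTypeOn Λ (insert I L) := by
  obtain ⟨κ, _, C, hfin, hC, hCL, hcog⟩ := exists_cogenerating_family R hL
  have hmain : ∀ (M : Type u) [AddCommGroup M] [Module Λ M] [Module.Finite Λ M],
      IsIndecomposableModule Λ M → grMeasure Λ M ∉ L →
      (∃ k, Nonempty (M ≃ₗ[Λ] (C k).carrier)) ∨
        ∃ k, GRlt (grMeasure Λ M) (grMeasure Λ (C k).carrier) := by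
    intro M _ _ _ hM hML
    rcases gabriel_main_property (Λ := Λ) _ M rfl hM (Σ k, M →ₗ[Λ] (C k).carrier)
      (fun f => (C f.1).carrier) (fun f => f.2) (fun f => hC f.1)
      (fun x hx => hcog M hM hML x fun k f => hx ⟨k, f⟩) with ⟨⟨k, f⟩, hf⟩ | ⟨⟨k, f⟩, hf⟩
    · exact Or.inl ⟨k, ⟨LinearEquiv.ofBijective f hf⟩⟩
    · exact Or.inr ⟨k, hf⟩
  have hle : ∀ J, IsGRMeasureOf Λ J → J ∉ L → ∃ k, GRle J (grMeasure Λ (C k).carrier) := by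
    rintro _ ⟨M, _, _, _, hM, rfl⟩ hML
    rcases hmain M hM hML with ⟨k, ⟨e⟩⟩ | ⟨k, hk⟩
    · exact ⟨k, Or.inl (grMeasure_congr e hM)⟩
    · exact ⟨k, Or.inr hk⟩
  obtain ⟨I₀, hI₀, hI₀L⟩ := hne
  obtain ⟨k₀, -⟩ := hle I₀ hI₀ hI₀L
  obtain ⟨_, ⟨k₁, rfl⟩, hmax⟩ := exists_grle_max
    (Set.finite_range fun k => grMeasure Λ (C k).carrier) ⟨_, k₀, rfl⟩
  refine ⟨_, ⟨(C k₁).carrier, _, _, hfin k₁, hC k₁, rfl⟩, hCL k₁, fun J hJ hJL => ?_, ?_⟩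
  · obtain ⟨k, hk⟩ := hle J hJ hJL
    exact hk.trans (hmax _ ⟨k, rfl⟩)
  · obtain ⟨n, A, -, -, -, hrep⟩ := hL
    refine isFiniteTypeOn_of_finite (Sum.elim A C) fun M _ _ _ hM hMI => ?_
    by_cases hML : grMeasure Λ M ∈ L
    · obtain ⟨i, hi⟩ := hrep M inferInstance hM hML
      exact ⟨Sum.inl i, hi⟩
    · rcases hmain M hM hML with ⟨k, hk⟩ | ⟨k, hk⟩
      · exact ⟨Sum.inr k, hk⟩
      · have := hmax _ ⟨k, rfl⟩
        rw [hMI.resolve_right hML] at hk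
        exact absurd hk this.not_grlt

end Landing

theorem isFiniteTypeOn_empty (Λ : Type u) [Ring Λ] : IsFiniteTypeOn Λ ∅ :=
  ⟨0, Fin.elim0, fun i => i.elim0, fun i => i.elim0, fun i => i.elim0, fun _ _ _ _ _ h => h.elim⟩

theorem IsFiniteTypeOn.exists_not_mem {Λ : Type u} [Ring Λ] {L : Set (Set ℕ)}
    (hL : IsFiniteTypeOn Λ L) (hinf : ¬ HasFiniteRepType Λ) : ∃ I, IsGRMeasureOf Λ I ∧ I ∉ L := by
  by_contra! hall
  obtain ⟨n, N, -, -, -, hrep⟩ := hL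
  exact hinf ⟨n, N, fun M _ _ hM hM' => hrep M hM hM' (hall _ ⟨M, _, _, hM, hM', rfl⟩)⟩

theorem exists_extremal_sequence {α : Type*} (r : α → α → Prop) (P : α → Prop) (F : Set α → Prop)
    (hF : F ∅) (hstep : ∀ L, F L → ∃ I, P I ∧ I ∉ L ∧
      (∀ J, P J → J ∉ L → J = I ∨ r I J) ∧ F (insert I L)) :
    ∃ s : ℕ → α, (∀ i, P (s i)) ∧ (∀ i, r (s i) (s (i + 1))) ∧
      ∀ J, P J → (∀ i, J ≠ s i) → ∀ i, r (s i) J := by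
  have : Nonempty α := ⟨(hstep ∅ hF).choose⟩
  choose! I hP hI hext hins using hstep
  let L : ℕ → Set α := fun n => Nat.rec ∅ (fun _ A => insert (I A) A) n
  have hL : ∀ n, F (L n) := by
    intro n
    induction n with
    | zero => exact hF
    | succ n ih => exact hins _ ih
  refine ⟨fun n => I (L n), fun n => hP _ (hL n), fun n => ?_, fun J hJ hne n => ?_⟩
  · have h : I (L (n + 1)) ∉ insert (I (L n)) (L n) := hI _ (hL (n + 1))
    rw [Set.mem_insert_iff, not_or] at h
    exact (hext _ (hL n) _ (hP _ (hL (n + 1))) h.2).resolve_left h.1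
  · have hJL : J ∉ L n := by
      induction n with
      | zero => exact fun h => h
      | succ n ih => exact fun h => h.elim (hne n) ih
    exact (hext _ (hL n) J hJ hJL).resolve_left (hne n)

/-- Let `Λ` be a representation-infinite artin algebra (an algebra over a
commutative artinian ring `R`, finitely generated as an `R`-module).  Then
there are GR measures `I₁ ≺ I₂ ≺ I₃ ≺ ⋯` (the take-off measures) and
`⋯ ≺ I³ ≺ I² ≺ I¹` (the landing measures) such that every GR measure `I` for
`Λ` not equal to any of them satisfies `Iᵢ ≺ I ≺ Iⁱ` for all `i`. -/
theorem takeoff_landing_partition (R : Type*) [CommRing R] [IsArtinianRing R]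
    (Λ : Type u) [Ring Λ] [Algebra R Λ] [Module.Finite R Λ]
    (hinf : ¬ HasFiniteRepType Λ) :
    ∃ lo hi : ℕ → Set ℕ,
      (∀ i, IsGRMeasureOf Λ (lo i)) ∧ (∀ i, IsGRMeasureOf Λ (hi i)) ∧
      (∀ i, GRlt (lo i) (lo (i + 1))) ∧ (∀ i, GRlt (hi (i + 1)) (hi i)) ∧
      ∀ I, IsGRMeasureOf Λ I → (∀ i, I ≠ lo i ∧ I ≠ hi i) →
        ∀ i, GRlt (lo i) I ∧ GRlt I (hi i) := by
  let Z := Subalgebra.center R Λ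
  have : IsArtinianRing Λ := IsArtinianRing.of_finite R Λ
  have : Module.Finite R Z := inferInstanceAs (Module.Finite R (Subalgebra.toSubmodule Z))
  have : IsArtinianRing Z := IsArtinianRing.of_finite R Z
  let _ : Algebra Z Λ := inferInstanceAs (Algebra (Subring.center Λ) Λ)
  have : IsScalarTower R Z Λ := ⟨fun a z x => smul_mul_assoc a (z : Λ) x⟩
  have : Module.Finite Z Λ := Module.Finite.of_restrictScalars_finite R Z Λ
  obtain ⟨lo, h₁, h₂, h₃⟩ := exists_extremal_sequence GRlt (IsGRMeasureOf Λ) (IsFiniteTypeOn Λ)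
    (isFiniteTypeOn_empty Λ) fun L hL => by
      obtain ⟨I, hI, hIL, hmin⟩ := exists_grle_min_not_mem Z hL (hL.exists_not_mem hinf)
      exact ⟨I, hI, hIL, fun J hJ hJL => (hmin J hJ hJL).imp Eq.symm id,
        hL.insert_min Z hIL hmin⟩
  obtain ⟨hi, h₄, h₅, h₆⟩ := exists_extremal_sequence (fun I J => GRlt J I) (IsGRMeasureOf Λ)
    (IsFiniteTypeOn Λ) (isFiniteTypeOn_empty Λ) fun L hL =>
      exists_grle_max_not_mem Z hL (hL.exists_not_mem hinf)
  exact ⟨lo, hi, h₁, h₄, h₂, h₅, fun I hI hne i =>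
    ⟨h₃ I hI (fun i => (hne i).1) i, h₆ I hI (fun i => (hne i).2) i⟩⟩
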